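/- arXiv:1912.08906 — 2 statements merged into one kernel-verified Lean document; each statement's English description precedes it below -/
import Mathlib

section
/- Let p be an odd prime, let G be a quasi-powerful p-group and let i be a nonnegative integer. If a, b ∈ G satisfy a^{p^i} = 1 and b^{p^i} = 1, then (a·b)^{p^i} = 1. (Equivalently, the subgroup Ω_i(G) has exponent dividing p^i, i.e. Ω_i(G) coincides with the set of elements of G of order dividing p^i.) -/
/-- The subgroup of `G` generated by all `n`-th powers. -/
def powSubgroup (G : Type*) [Group G] (n : ℕ) : Subgroup G :=
  Subgroup.closure {x : G | ∃ g : G, g ^ n = x}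

/-- `Ω_k`-type subgroup: generated by all elements whose `n`-th power is trivial. -/
def omegaSubgroup (G : Type*) [Group G] (n : ℕ) : Subgroup G :=
  Subgroup.closure {g : G | g ^ n = 1}

/-- A group is powerful (for a prime `p`) if `[G,G] ≤ G^p`. -/
def IsPowerful (p : ℕ) (G : Type*) [Group G] : Prop :=
  commutator G ≤ powSubgroup G p

/-- A group is quasi-powerful (for a prime `p`) if `G/Z(G)` is powerful. -/
def IsQuasiPowerful (p : ℕ) (G : Type*) [Group G] : Prop :=
  IsPowerful p (G ⧸ Subgroup.center G)

/-- The commutator `[x,y] = x⁻¹y⁻¹xy`. -/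
def pcomm {G : Type*} [Group G] (a b : G) : G := a⁻¹ * b⁻¹ * a * b

lemma pow_mul_eq_mul_pow_of_commutes {G : Type*} [Group G] {a b t : G} (h : b * a = a * b * t)
    (tb : Commute t b) (n : ℕ) : b ^ n * a = a * b ^ n * t ^ n := by
  induction n with
  | zero => simp
  | succ n ih =>
    have h1 : Commute (b ^ n) t := (tb.pow_right n).symm
    calc b ^ (n + 1) * a = b ^ n * (b * a) := by rw [pow_succ, mul_assoc]
      _ = (b ^ n * a) * (b * t) := by rw [h]; group
      _ = a * b ^ n * (t ^ n * b) * t := by rw [ih]; group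
      _ = a * b ^ n * (b * t ^ n) * t := by rw [(tb.pow_left n).eq]
      _ = _ := by rw [pow_succ, pow_succ]; group

lemma mul_pow_eq_of_commutes {G : Type*} [Group G] {a b t : G} (h : b * a = a * b * t)
    (ta : Commute t a) (tb : Commute t b) (n : ℕ) :
    (a * b) ^ n = a ^ n * b ^ n * t ^ n.choose 2 := by
  induction n with
  | zero => simp
  | succ n ih =>
    have e : (n + 1).choose 2 = n + n.choose 2 := by
      rw [Nat.choose_succ_succ' n 1, Nat.choose_one_right]
    have hab : Commute (t ^ n.choose 2) (a * b) := (ta.mul_right tb).pow_left _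
    calc (a * b) ^ (n + 1) = a ^ n * b ^ n * (t ^ n.choose 2 * (a * b)) := by
          rw [pow_succ, ih, mul_assoc]
      _ = a ^ n * (b ^ n * a) * b * t ^ n.choose 2 := by rw [hab.eq]; group
      _ = a ^ n * a * b ^ n * (t ^ n * b) * t ^ n.choose 2 := by
          rw [pow_mul_eq_mul_pow_of_commutes h tb]; group
      _ = a ^ n * a * b ^ n * (b * t ^ n) * t ^ n.choose 2 := by rw [(tb.pow_left n).eq]
      _ = _ := by rw [e, pow_add, pow_succ, pow_succ]; group

lemma dvd_choose_two_of_odd {p : ℕ} (hp : Odd p) : p ∣ p.choose 2 := by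
  obtain ⟨k, rfl⟩ := hp
  refine ⟨k, ?_⟩
  rw [Nat.choose_two_right]
  have : (2 * k + 1) * (2 * k + 1 - 1) = 2 * ((2 * k + 1) * k) := by
    rw [Nat.add_sub_cancel]; ring
  rw [this, Nat.mul_div_cancel_left _ two_pos]

/-- In class two, the `p`-th power is multiplicative once the commutator has exponent `p`. -/
lemma mul_pow_odd {G : Type*} [Group G] {p : ℕ} (hp : Odd p) {a b t : G}
    (h : b * a = a * b * t) (ta : Commute t a) (tb : Commute t b) (hb : Commute (b ^ p) a) :
    (a * b) ^ p = a ^ p * b ^ p := by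
  have h1 : t ^ p = 1 := by
    have h2 := pow_mul_eq_mul_pow_of_commutes h tb p
    rw [hb.eq] at h2
    simpa using h2
  obtain ⟨k, hk⟩ := dvd_choose_two_of_odd hp
  rw [mul_pow_eq_of_commutes h ta tb, hk, pow_mul, h1, one_pow, mul_one]

/-- The subgroup generated by the `p`-th powers of the elements of `H`. -/
def powOf {G : Type*} [Group G] (p : ℕ) (H : Subgroup G) : Subgroup G :=
  Subgroup.closure {x | ∃ h ∈ H, h ^ p = x}

section PowOf

variable {G G' : Type*} [Group G] [Group G'] {p : ℕ}

lemma powOf_top : powOf p (⊤ : Subgroup G) = powSubgroup G p := by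
  simp [powOf, powSubgroup]

lemma pow_mem_powOf {H : Subgroup G} {h : G} (hh : h ∈ H) : h ^ p ∈ powOf p H :=
  Subgroup.subset_closure ⟨h, hh, rfl⟩

lemma powOf_le_iff {H K : Subgroup G} : powOf p H ≤ K ↔ ∀ h ∈ H, h ^ p ∈ K := by
  rw [powOf, Subgroup.closure_le]
  exact ⟨fun h x hx => h ⟨x, hx, rfl⟩, fun h x ⟨y, hy, e⟩ => e ▸ h y hy⟩

lemma powOf_mono {H K : Subgroup G} (h : H ≤ K) : powOf p H ≤ powOf p K :=
  powOf_le_iff.2 fun _ hx => pow_mem_powOf (h hx)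

lemma map_powOf (f : G →* G') (H : Subgroup G) : (powOf p H).map f = powOf p (H.map f) := by
  apply le_antisymm
  · rw [Subgroup.map_le_iff_le_comap, powOf_le_iff]
    intro h hh
    rw [Subgroup.mem_comap, map_pow]
    exact pow_mem_powOf (Subgroup.mem_map_of_mem f hh)
  · rw [powOf_le_iff]
    rintro _ ⟨h, hh, rfl⟩
    rw [← map_pow]
    exact Subgroup.mem_map_of_mem f (pow_mem_powOf hh)

instance powOf_normal (H : Subgroup G) [hH : H.Normal] : (powOf p H).Normal := by
  constructor
  intro n hn g
  have h1 : (powOf p H).map (MulAut.conj g).toMonoidHom ≤ powOf p H := by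
    rw [map_powOf]
    apply powOf_mono
    rintro _ ⟨h, hh, rfl⟩
    exact hH.conj_mem h hh g
  exact h1 (Subgroup.mem_map_of_mem _ hn)

end PowOf

/-- In a nilpotent group, a subgroup contained in `V[X,G]` is contained in `V`. -/
lemma le_of_le_sup_commutator {G : Type*} [Group G] [Group.IsNilpotent G] {X V : Subgroup G}
    [V.Normal] (h : X ≤ V ⊔ ⁅X, (⊤ : Subgroup G)⁆) : X ≤ V := by
  have h1 : X.map (QuotientGroup.mk' V) ≤ ⁅X.map (QuotientGroup.mk' V), ⊤⁆ := by
    have h2 := Subgroup.map_mono (f := QuotientGroup.mk' V) h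
    rwa [Subgroup.map_sup, QuotientGroup.map_mk'_self, bot_sup_eq, Subgroup.map_commutator,
      Subgroup.map_top_of_surjective _ (QuotientGroup.mk'_surjective V)] at h2
  have key : ∀ n, X.map (QuotientGroup.mk' V) ≤ (⊤ : Subgroup (G ⧸ V)).lowerCentralSeries n := by
    intro n
    induction n with
    | zero => simp
    | succ n ih => exact h1.trans (Subgroup.commutator_mono ih le_rfl)
  obtain ⟨n, hn⟩ := Subgroup.nilpotent_iff_lowerCentralSeries.1
    (inferInstance : Group.IsNilpotent (G ⧸ V))
  have h3 := key n
  rwa [hn, Subgroup.map_le_iff_le_comap, MonoidHom.comap_bot, QuotientGroup.ker_mk'] at h3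

open scoped commutatorElement

lemma mk_mem_center_iff {G : Type*} [Group G] {W : Subgroup G} [W.Normal] {m : G} :
    (m : G ⧸ W) ∈ Subgroup.center (G ⧸ W) ↔ ∀ g, ⁅m, g⁆ ∈ W := by
  rw [Subgroup.mem_center_iff]
  constructor
  · intro h g
    rw [← QuotientGroup.eq_one_iff, ← QuotientGroup.mk'_apply, map_commutatorElement,
      commutatorElement_eq_one_iff_mul_comm]
    exact (h _).symm
  · intro h g
    obtain ⟨g, rfl⟩ := QuotientGroup.mk_surjective g
    have h1 := h g
    rw [← QuotientGroup.eq_one_iff, ← QuotientGroup.mk'_apply, map_commutatorElement,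
      commutatorElement_eq_one_iff_mul_comm] at h1
    exact h1.symm

/-- If `N` is powerfully embedded, so is the subgroup generated by its `p`-th powers. -/
lemma commutator_powOf_le {G : Type*} [Group G] [Group.IsNilpotent G] {p : ℕ} (hp : Odd p)
    {N : Subgroup G} [N.Normal] (hN : ⁅N, (⊤ : Subgroup G)⁆ ≤ powOf p N) :
    ⁅powOf p N, (⊤ : Subgroup G)⁆ ≤ powOf p (powOf p N) := by
  apply le_of_le_sup_commutator
  set M := powOf p N
  set W := powOf p M ⊔ ⁅⁅M, (⊤ : Subgroup G)⁆, ⊤⁆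
  suffices h : M ≤ (Subgroup.center (G ⧸ W)).comap (QuotientGroup.mk' W) by
    rw [Subgroup.commutator_le]
    exact fun m hm g _ => mk_mem_center_iff.1 (h hm) g
  rw [powOf_le_iff]
  intro n hn
  rw [Subgroup.mem_comap, Subgroup.mem_center_iff]
  intro g
  obtain ⟨g, rfl⟩ := QuotientGroup.mk_surjective g
  -- `c` is defined by `g⁻¹ * n * g = n * c`
  have hc : ⁅n⁻¹, g⁻¹⁆ ∈ M :=
    hN (Subgroup.commutator_mem_commutator (N.inv_mem hn) (Subgroup.mem_top _))
  set c := ⁅n⁻¹, g⁻¹⁆ with hcdef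
  have hcp : ((c : G ⧸ W)) ^ p = 1 := by
    rw [← QuotientGroup.mk_pow, QuotientGroup.eq_one_iff]
    exact (le_sup_left : _ ≤ W) (pow_mem_powOf hc)
  set t := ⁅c⁻¹, n⁻¹⁆ with htdef
  have ht : (t : G ⧸ W) ∈ Subgroup.center (G ⧸ W) := by
    refine mk_mem_center_iff.2 fun k => (le_sup_right : _ ≤ W) ?_
    exact Subgroup.commutator_mem_commutator
      (Subgroup.commutator_mem_commutator (M.inv_mem hc) (Subgroup.mem_top _)) (Subgroup.mem_top _)
  have e1 : (c : G ⧸ W) * n = n * c * t := by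
    rw [← QuotientGroup.mk_mul, ← QuotientGroup.mk_mul, ← QuotientGroup.mk_mul, htdef,
      commutatorElement_def]
    congr 1; group
  have e2 : (g : G ⧸ W)⁻¹ * n * g = n * c := by
    rw [← QuotientGroup.mk_inv, ← QuotientGroup.mk_mul, ← QuotientGroup.mk_mul,
      ← QuotientGroup.mk_mul, hcdef, commutatorElement_def]
    congr 1; group
  have e3 := mul_pow_odd hp e1 (Subgroup.mem_center_iff.1 ht _).symm
    (Subgroup.mem_center_iff.1 ht _).symm (by rw [hcp]; exact Commute.one_left _)
  rw [hcp, mul_one, ← e2] at e3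
  have e4 := conj_pow (i := p) (a := (g : G ⧸ W)⁻¹) (b := (n : G ⧸ W))
  rw [inv_inv, e3] at e4
  simp only [QuotientGroup.mk'_apply, QuotientGroup.mk_pow]
  nth_rw 1 [e4]
  group

lemma commutator_zpowers_sup_le {G : Type*} [Group G] {M W : Subgroup G} [M.Normal] [W.Normal]
    (h : ⁅M, (⊤ : Subgroup G)⁆ ≤ W) (x : G) :
    ⁅Subgroup.zpowers x ⊔ M, Subgroup.zpowers x ⊔ M⁆ ≤ W := by
  rw [Subgroup.commutator_le]
  intro a ha b hb
  obtain ⟨_, ⟨i, rfl⟩, m, hm, rfl⟩ := Subgroup.mem_sup_of_normal_right.1 ha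
  obtain ⟨_, ⟨j, rfl⟩, k, hk, rfl⟩ := Subgroup.mem_sup_of_normal_right.1 hb
  have h1 : ∀ m ∈ M, (m : G ⧸ W) ∈ Subgroup.center (G ⧸ W) := fun m hm =>
    mk_mem_center_iff.2 fun g => h (Subgroup.commutator_mem_commutator hm (Subgroup.mem_top _))
  have c1 : ∀ u : G ⧸ W, Commute (m : G ⧸ W) u := fun u =>
    (Subgroup.mem_center_iff.1 (h1 m hm) u).symm
  have c2 : ∀ u : G ⧸ W, Commute u (k : G ⧸ W) := fun u =>
    Subgroup.mem_center_iff.1 (h1 k hk) u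
  rw [← QuotientGroup.eq_one_iff, ← QuotientGroup.mk'_apply, map_commutatorElement,
    commutatorElement_eq_one_iff_commute]
  simp only [map_mul, map_zpow, QuotientGroup.mk'_apply]
  refine Commute.mul_left (Commute.mul_right ?_ (c2 _)) (c1 _)
  exact (Commute.refl (x : G ⧸ W)).zpow_zpow i j

/-- In a finite `p`-group, the subgroup generated by `p`-th powers consists of non-generators. -/
lemma eq_top_of_sup_powOf_eq_top {p : ℕ} [Fact p.Prime] {G : Type*} [Group G] [Finite G]
    (hG : IsPGroup p G) {H : Subgroup G} (h : H ⊔ powOf p ⊤ = ⊤) : H = ⊤ := by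
  have := hG.isNilpotent
  by_contra hH
  obtain ⟨N, hN, hHN⟩ := (eq_top_or_exists_le_coatom H).resolve_left hH
  have hNn : N.Normal := Subgroup.NormalizerCondition.normal_of_coatom N
    Group.normalizerCondition_of_isNilpotent hN
  apply hN.1
  rw [eq_top_iff, ← h]
  refine sup_le hHN (powOf_le_iff.2 fun g _ => ?_)
  by_contra hg
  have h1 : N ⊔ Subgroup.zpowers (g ^ p) = ⊤ :=
    hN.2 _ (left_lt_sup.2 fun h => hg (h (Subgroup.mem_zpowers _)))
  have h2 : g ∈ N ⊔ Subgroup.zpowers (g ^ p) := h1 ▸ Subgroup.mem_top g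
  obtain ⟨n, hn, _, ⟨i, rfl⟩, e⟩ := Subgroup.mem_sup_of_normal_left.1 h2
  have e1 : (g : G ⧸ N) = ((g : G ⧸ N) ^ p) ^ i := by
    have e3 := congrArg (QuotientGroup.mk' N) e
    simpa [(QuotientGroup.eq_one_iff n).2 hn] using e3.symm
  obtain ⟨k, hk⟩ := hG g
  have e2 : ∀ j : ℕ, (g : G ⧸ N) ^ p ^ j = 1 → (g : G ⧸ N) = 1 := by
    intro j
    induction j with
    | zero => simp
    | succ j ih =>
      intro hj
      apply ih
      rw [e1, ← zpow_natCast, ← zpow_mul, mul_comm, zpow_mul, zpow_natCast, ← pow_mul,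
        ← pow_succ', hj, one_zpow]
  apply hg
  rw [← QuotientGroup.eq_one_iff, QuotientGroup.mk_pow,
    e2 k (by rw [← QuotientGroup.mk_pow, hk, QuotientGroup.mk_one]), one_pow]

lemma map_subtype_powOf_top {G : Type*} [Group G] {p : ℕ} (H : Subgroup G) :
    (powOf p (⊤ : Subgroup H)).map H.subtype = powOf p H := by
  rw [map_powOf, ← MonoidHom.range_eq_map, Subgroup.range_subtype]

/-- In a powerful `p`-group, `p` odd, every element of `G^p` is a `p`-th power. -/
lemma exists_pow_eq_of_mem_powOf {p : ℕ} [Fact p.Prime] (hp : Odd p) {G : Type*} [Group G]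
    [Finite G] (hG : IsPGroup p G) (hP : commutator G ≤ powOf p ⊤) {g : G}
    (hg : g ∈ powOf p (⊤ : Subgroup G)) : ∃ h, h ^ p = g := by
  induction hn : Nat.card G using Nat.strong_induction_on generalizing G with
  | _ n ih =>
  subst hn
  have := hG.isNilpotent
  set M : Subgroup G := powOf p ⊤ with hM
  have hV : ⁅M, (⊤ : Subgroup G)⁆ ≤ powOf p M := commutator_powOf_le hp hP
  set V := powOf p M with hVdef
  obtain ⟨x, hx⟩ : ∃ x : G, (x : G ⧸ V) ^ p = g := by
    induction hg using Subgroup.closure_induction with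
    | mem y hy =>
      obtain ⟨z, -, rfl⟩ := hy
      exact ⟨z, by simp⟩
    | one => exact ⟨1, by simp⟩
    | inv y _ hy =>
      obtain ⟨z, hz⟩ := hy
      exact ⟨z⁻¹, by simp [hz]⟩
    | mul y z _ _ hy hz =>
      obtain ⟨a, ha⟩ := hy
      obtain ⟨b, hb⟩ := hz
      refine ⟨a * b, ?_⟩
      have hcen : ∀ m ∈ M, ∀ u : G ⧸ V, Commute (m : G ⧸ V) u := fun m hm u =>
        (Subgroup.mem_center_iff.1 (mk_mem_center_iff.2 fun k =>
          hV (Subgroup.commutator_mem_commutator hm (Subgroup.mem_top k))) u).symm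
      have ht : ⁅b⁻¹, a⁻¹⁆ ∈ M :=
        hP (Subgroup.commutator_mem_commutator (Subgroup.mem_top _) (Subgroup.mem_top _))
      have e1 : (b : G ⧸ V) * a = a * b * (⁅b⁻¹, a⁻¹⁆ : G) := by
        rw [← QuotientGroup.mk_mul, ← QuotientGroup.mk_mul, ← QuotientGroup.mk_mul,
          commutatorElement_def]
        congr 1; group
      have e2 := mul_pow_odd hp e1 (hcen _ ht _) (hcen _ ht _)
        (by rw [← QuotientGroup.mk_pow]; exact hcen _ (pow_mem_powOf (Subgroup.mem_top _)) _)
      rw [QuotientGroup.mk_mul, e2, ha, hb, QuotientGroup.mk_mul]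
  set K := Subgroup.zpowers x ⊔ M with hK
  have hMK : M ≤ K := le_sup_right
  have hxK : x ∈ K := (le_sup_left : _ ≤ K) (Subgroup.mem_zpowers x)
  have hKK : ⁅K, K⁆ ≤ powOf p K := (commutator_zpowers_sup_le hV x).trans (powOf_mono hMK)
  by_cases hKt : K = ⊤
  · have hx : Subgroup.zpowers x = ⊤ := eq_top_of_sup_powOf_eq_top hG hKt
    have h1 : M ≤ Subgroup.zpowers (x ^ p) := by
      rw [hM, powOf_le_iff]
      intro y _
      obtain ⟨i, rfl⟩ : y ∈ Subgroup.zpowers x := hx ▸ Subgroup.mem_top y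
      exact ⟨i, by simp only [← zpow_natCast, ← zpow_mul, mul_comm]⟩
    obtain ⟨i, rfl⟩ := h1 hg
    exact ⟨x ^ i, by simp only [← zpow_natCast, ← zpow_mul, mul_comm]⟩
  · have hgK : g ∈ powOf p K := by
      rw [← QuotientGroup.mk_pow, QuotientGroup.eq] at hx
      have h2 := (powOf p K).mul_mem (pow_mem_powOf hxK) (powOf_mono hMK hx)
      simpa using h2
    rw [← map_subtype_powOf_top] at hgK
    obtain ⟨g', hg', rfl⟩ := hgK
    have hKP : commutator K ≤ powOf p ⊤ := by
      rw [← Subgroup.map_le_map_iff_of_injective K.subtype_injective, map_subtype_powOf_top,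
        Subgroup.map_subtype_commutator]
      exact hKK
    have hcard : Nat.card K < Nat.card G :=
      lt_of_le_of_ne (Subgroup.card_le_card_group K) fun h => hKt (Subgroup.eq_top_of_card_eq K h)
    obtain ⟨h, rfl⟩ := ih _ hcard (hG.to_subgroup K) hKP hg' rfl
    exact ⟨h, by simp⟩

lemma exists_mem_pow_eq_of_mem_powOf {p : ℕ} [Fact p.Prime] (hp : Odd p) {G : Type*} [Group G]
    [Finite G] (hG : IsPGroup p G) {H : Subgroup G} (hH : ⁅H, H⁆ ≤ powOf p H) {g : G}
    (hg : g ∈ powOf p H) : ∃ h ∈ H, h ^ p = g := by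
  rw [← map_subtype_powOf_top] at hg
  obtain ⟨g', hg', rfl⟩ := hg
  have hHP : commutator H ≤ powOf p ⊤ := by
    rw [← Subgroup.map_le_map_iff_of_injective H.subtype_injective, map_subtype_powOf_top,
      Subgroup.map_subtype_commutator]
    exact hH
  obtain ⟨h, rfl⟩ := exists_pow_eq_of_mem_powOf hp (hG.to_subgroup H) hHP hg'
  exact ⟨h, h.2, by simp⟩

/-- The series `G`, `G^p`, `(G^p)^p`, … -/
def powSeries (p : ℕ) (G : Type*) [Group G] : ℕ → Subgroup G
  | 0 => ⊤
  | k + 1 => powOf p (powSeries p G k)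

section PowSeries

variable {p : ℕ} {G : Type*} [Group G]

instance powSeries_normal (k : ℕ) : (powSeries p G k).Normal := by
  induction k with
  | zero => exact Subgroup.normal_top
  | succ k ih => exact powOf_normal _

lemma commutator_powSeries_le [Group.IsNilpotent G] (hp : Odd p) (hP : commutator G ≤ powOf p ⊤)
    (k : ℕ) : ⁅powSeries p G k, (⊤ : Subgroup G)⁆ ≤ powSeries p G (k + 1) := by
  induction k with
  | zero => exact hP
  | succ k ih => exact commutator_powOf_le hp ih

lemma exists_pow_eq_of_mem_powSeries [Fact p.Prime] (hp : Odd p) [Finite G] (hG : IsPGroup p G)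
    (hP : commutator G ≤ powOf p ⊤) {k : ℕ} {x : G} (hx : x ∈ powSeries p G k) :
    ∃ u, u ^ p ^ k = x := by
  have := hG.isNilpotent
  induction k generalizing x with
  | zero => exact ⟨x, by simp⟩
  | succ k ih =>
    have h1 : ⁅powSeries p G k, powSeries p G k⁆ ≤ powOf p (powSeries p G k) :=
      (Subgroup.commutator_mono le_rfl le_top).trans (commutator_powSeries_le hp hP k)
    obtain ⟨y, hy, rfl⟩ := exists_mem_pow_eq_of_mem_powOf hp hG h1 hx
    obtain ⟨u, rfl⟩ := ih hy
    exact ⟨u, by rw [pow_succ, pow_mul]⟩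

end PowSeries

section QuasiPowerful

variable {p : ℕ} {G : Type*} [Group G]

lemma isQuasiPowerful_iff :
    IsQuasiPowerful p G ↔ commutator G ≤ powOf p ⊤ ⊔ Subgroup.center G := by
  have hs := QuotientGroup.mk'_surjective (Subgroup.center G)
  have h1 : commutator (G ⧸ Subgroup.center G) =
      (commutator G).map (QuotientGroup.mk' (Subgroup.center G)) := by
    rw [commutator_def, commutator_def, Subgroup.map_commutator,
      Subgroup.map_top_of_surjective _ hs]
  have h2 : powSubgroup (G ⧸ Subgroup.center G) p =
      (powOf p (⊤ : Subgroup G)).map (QuotientGroup.mk' (Subgroup.center G)) := by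
    rw [map_powOf, Subgroup.map_top_of_surjective _ hs, powOf_top]
  rw [IsQuasiPowerful, IsPowerful, h1, h2, Subgroup.map_le_iff_le_comap, Subgroup.comap_map_eq,
    QuotientGroup.ker_mk']

lemma IsQuasiPowerful.quotient (h : IsQuasiPowerful p G) (N : Subgroup G) [N.Normal] :
    IsQuasiPowerful p (G ⧸ N) := by
  have hs := QuotientGroup.mk'_surjective N
  rw [isQuasiPowerful_iff] at h ⊢
  have h1 := Subgroup.map_mono (f := QuotientGroup.mk' N) h
  rw [commutator_def, Subgroup.map_commutator, Subgroup.map_sup, map_powOf,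
    Subgroup.map_top_of_surjective _ hs] at h1
  refine h1.trans (sup_le_sup le_rfl ?_)
  rintro _ ⟨z, hz, rfl⟩
  refine Subgroup.mem_center_iff.2 fun g => ?_
  obtain ⟨g, rfl⟩ := hs g
  rw [← map_mul, ← map_mul, Subgroup.mem_center_iff.1 hz g]

lemma isQuasiPowerful_subgroup {K : Subgroup G} (hZ : Subgroup.center G ≤ K)
    (h : ⁅K, K⁆ ≤ powOf p K ⊔ Subgroup.center G) : IsQuasiPowerful p K := by
  rw [isQuasiPowerful_iff, ← Subgroup.map_le_map_iff_of_injective K.subtype_injective,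
    Subgroup.map_sup, map_subtype_powOf_top, Subgroup.map_subtype_commutator]
  refine h.trans (sup_le_sup le_rfl fun z hz => ⟨⟨z, hZ hz⟩, ?_, rfl⟩)
  exact Subgroup.mem_center_iff.2 fun g => Subtype.ext (Subgroup.mem_center_iff.1 hz g)

/-- The preimage in `G` of `powSeries` of `G/Z(G)`. -/
def centralPowSeries (p : ℕ) (G : Type*) [Group G] (k : ℕ) : Subgroup G :=
  (powSeries p (G ⧸ Subgroup.center G) k).comap (QuotientGroup.mk' (Subgroup.center G))

instance centralPowSeries_normal (k : ℕ) : (centralPowSeries p G k).Normal :=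
  Subgroup.normal_comap _

lemma center_le_centralPowSeries (k : ℕ) : Subgroup.center G ≤ centralPowSeries p G k := by
  intro z hz
  rw [centralPowSeries, Subgroup.mem_comap, QuotientGroup.mk'_apply,
    (QuotientGroup.eq_one_iff z).2 hz]
  exact one_mem _

lemma pow_mem_centralPowSeries (x : G) (k : ℕ) : x ^ p ^ k ∈ centralPowSeries p G k := by
  induction k with
  | zero => exact Subgroup.mem_top _
  | succ k ih =>
    rw [pow_succ, pow_mul, centralPowSeries, Subgroup.mem_comap, map_pow]
    exact pow_mem_powOf ih

variable [Fact p.Prime] [Finite G]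

lemma commutatorElement_mem_centralPowSeries (hp : Odd p) (hG : IsPGroup p G)
    (hQ : IsQuasiPowerful p G) {k : ℕ} {x : G} (hx : x ∈ centralPowSeries p G k) (g : G) :
    ⁅x, g⁆ ∈ centralPowSeries p G (k + 1) := by
  have := (hG.to_quotient (Subgroup.center G)).isNilpotent
  rw [IsQuasiPowerful, IsPowerful, ← powOf_top] at hQ
  rw [centralPowSeries, Subgroup.mem_comap, map_commutatorElement]
  exact commutator_powSeries_le hp hQ k
    (Subgroup.commutator_mem_commutator hx (Subgroup.mem_top _))

lemma exists_eq_pow_mul_of_mem_centralPowSeries (hp : Odd p) (hG : IsPGroup p G)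
    (hQ : IsQuasiPowerful p G) {k : ℕ} {x : G} (hx : x ∈ centralPowSeries p G k) :
    ∃ u, ∃ z ∈ Subgroup.center G, x = u ^ p ^ k * z := by
  rw [IsQuasiPowerful, IsPowerful, ← powOf_top] at hQ
  obtain ⟨u, hu⟩ := exists_pow_eq_of_mem_powSeries hp (hG.to_quotient _) hQ hx
  obtain ⟨u, rfl⟩ := QuotientGroup.mk'_surjective _ u
  rw [← map_pow, QuotientGroup.mk'_apply, QuotientGroup.mk'_apply, QuotientGroup.eq] at hu
  exact ⟨u, _, hu, by group⟩

lemma isQuasiPowerful_zpowers_sup (hp : Odd p) (hG : IsPGroup p G) (hQ : IsQuasiPowerful p G)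
    (y : G) :
    IsQuasiPowerful p (Subgroup.zpowers y ⊔ centralPowSeries p G 1 : Subgroup G) := by
  have := (hG.to_quotient (Subgroup.center G)).isNilpotent
  rw [IsQuasiPowerful, IsPowerful, ← powOf_top] at hQ
  set K : Subgroup G := Subgroup.zpowers y ⊔ centralPowSeries p G 1 with hK
  apply isQuasiPowerful_subgroup ((center_le_centralPowSeries 1).trans le_sup_right)
  have h1 := commutator_zpowers_sup_le (commutator_powSeries_le hp hQ 1)
    (QuotientGroup.mk' (Subgroup.center G) y)
  have h2 : K.map (QuotientGroup.mk' (Subgroup.center G)) =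
      Subgroup.zpowers (QuotientGroup.mk' (Subgroup.center G) y) ⊔
        powSeries p (G ⧸ Subgroup.center G) 1 := by
    rw [hK, Subgroup.map_sup, MonoidHom.map_zpowers, centralPowSeries,
      Subgroup.map_comap_eq_self_of_surjective (QuotientGroup.mk'_surjective _)]
  rw [← h2, ← Subgroup.map_commutator] at h1
  have h3 : powSeries p (G ⧸ Subgroup.center G) 2 ≤
      (powOf p K).map (QuotientGroup.mk' (Subgroup.center G)) := by
    rw [map_powOf, h2]
    exact powOf_mono le_sup_right
  have h4 := h1.trans h3
  rwa [Subgroup.map_le_iff_le_comap, Subgroup.comap_map_eq, QuotientGroup.ker_mk'] at h4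

lemma zpowers_sup_centralPowSeries_ne_top (hG : IsPGroup p G) {a b : G} (hab : ¬ Commute a b)
    (y : G) : Subgroup.zpowers y ⊔ centralPowSeries p G 1 ≠ ⊤ := by
  intro h
  have h1 := congrArg (Subgroup.map (QuotientGroup.mk' (Subgroup.center G))) h
  rw [Subgroup.map_sup, MonoidHom.map_zpowers, centralPowSeries,
    Subgroup.map_comap_eq_self_of_surjective (QuotientGroup.mk'_surjective _),
    Subgroup.map_top_of_surjective _ (QuotientGroup.mk'_surjective _)] at h1
  have h2 := eq_top_of_sup_powOf_eq_top (hG.to_quotient _) h1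
  have : IsCyclic (G ⧸ Subgroup.center G) :=
    isCyclic_iff_exists_zpowers_eq_top.2 ⟨_, h2⟩
  have := MonoidHom.isMulCommutative_of_isCyclic_of_ker_le_center
    (QuotientGroup.mk' (Subgroup.center G))
    (by rw [QuotientGroup.ker_mk'])
  exact hab (mul_comm' a b)

end QuasiPowerful

/-- Powers in `G` behave modulo the centre as in a powerful Lie ring: `[p^m x, y] = [x, p^m y]`,
and `p` is additive on the elements of order `p`. -/
structure IsPowerRegular (p : ℕ) (G : Type*) [Group G] : Prop where
  commute_pow : ∀ (m : ℕ) (x y : G), x ^ p ^ (m + 1) ∈ Subgroup.center G →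
    y ^ p ^ m ∈ Subgroup.center G → Commute (x ^ p ^ m) y
  mul_pow : ∀ a b : G, a ^ p ∈ Subgroup.center G → b ^ p ∈ Subgroup.center G →
    (a * b) ^ p = a ^ p * b ^ p

lemma isPowerRegular_of_commute {p : ℕ} {G : Type*} [Group G] (h : ∀ a b : G, Commute a b) :
    IsPowerRegular p G :=
  ⟨fun _ _ _ _ _ => h _ _, fun a b _ _ => (h a b).mul_pow p⟩

lemma mem_center_of_coe_mem {G : Type*} [Group G] {K : Subgroup G} {a : K}
    (h : (a : G) ∈ Subgroup.center G) : a ∈ Subgroup.center K :=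
  Subgroup.mem_center_iff.2 fun g => Subtype.ext (Subgroup.mem_center_iff.1 h g)

lemma IsPowerRegular.mul_pow_of_mem {p : ℕ} {G : Type*} [Group G] {K : Subgroup G}
    (h : IsPowerRegular p K) {a b : G} (haK : a ∈ K) (hbK : b ∈ K)
    (ha : a ^ p ∈ Subgroup.center G) (hb : b ^ p ∈ Subgroup.center G) :
    (a * b) ^ p = a ^ p * b ^ p :=
  congrArg Subtype.val (h.mul_pow ⟨a, haK⟩ ⟨b, hbK⟩ (mem_center_of_coe_mem ha)
    (mem_center_of_coe_mem hb))

lemma IsPowerRegular.commute_pow_of_mem {p : ℕ} {G : Type*} [Group G] {K : Subgroup G}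
    (h : IsPowerRegular p K) {a b : G} (haK : a ∈ K) (hbK : b ∈ K)
    (ha : a ^ p ^ 2 ∈ Subgroup.center G) (hb : b ^ p ∈ Subgroup.center G) :
    Commute (a ^ p) b := by
  have h1 := h.commute_pow 1 ⟨a, haK⟩ ⟨b, hbK⟩ (mem_center_of_coe_mem ha)
    (mem_center_of_coe_mem (by simpa using hb))
  rw [commute_iff_eq]
  simpa using congrArg Subtype.val h1.eq

/-- A quasi-powerful group inherits `IsPowerRegular` from its subgroups `⟨y⟩ G^p Z(G)` and its
proper quotients. -/
theorem isPowerRegular_of_subgroup_of_quotient {p : ℕ} [Fact p.Prime] (hp : Odd p) {G : Type*}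
    [Group G] [Finite G] [Nontrivial G] (hG : IsPGroup p G) (hQ : IsQuasiPowerful p G)
    (hsub : ∀ y : G, IsPowerRegular p (Subgroup.zpowers y ⊔ centralPowSeries p G 1 : Subgroup G))
    (hquot : ∀ (N : Subgroup G) [N.Normal], N ≠ ⊥ → IsPowerRegular p (G ⧸ N)) :
    IsPowerRegular p G := by
  set P := centralPowSeries p G 1
  set Z := Subgroup.center G
  have hPK : ∀ y, P ≤ Subgroup.zpowers y ⊔ P := fun y => le_sup_right
  have hyK : ∀ y, y ∈ Subgroup.zpowers y ⊔ P := fun y =>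
    (le_sup_left : Subgroup.zpowers y ≤ _) (Subgroup.mem_zpowers y)
  let T : Subgroup G :=
    { carrier := {t | t ∈ P ∧ t ^ p = 1}
      one_mem' := ⟨one_mem _, one_pow _⟩
      inv_mem' := fun {t} ht => ⟨inv_mem ht.1, by rw [inv_pow, ht.2, inv_one]⟩
      mul_mem' := fun {s t} hs ht => ⟨mul_mem hs.1 ht.1, by
        rw [(hsub 1).mul_pow_of_mem (hPK 1 hs.1) (hPK 1 ht.1) (hs.2 ▸ one_mem _)
          (ht.2 ▸ one_mem _), hs.2, ht.2, one_mul]⟩ }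
  have hTn : T.Normal := by
    constructor
    rintro t ⟨h1, h2⟩ g
    exact ⟨(centralPowSeries_normal 1).conj_mem t h1 g, by rw [conj_pow, h2]; group⟩
  have hT : T ≠ ⊥ := by
    have := hG.center_nontrivial
    have h1 : p ∣ Nat.card Z :=
      (hG.to_subgroup Z).card_eq_or_dvd.resolve_left Finite.one_lt_card.ne'
    obtain ⟨z, hz⟩ := exists_prime_orderOf_dvd_card' p h1
    intro h
    have h2 : (z : G) ∈ T :=
      ⟨center_le_centralPowSeries 1 z.2, by
        rw [← Subgroup.coe_pow, ← hz, pow_orderOf_eq_one, Subgroup.coe_one]⟩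
    rw [h, Subgroup.mem_bot] at h2
    have h3 : z = 1 := Subtype.ext h2
    rw [h3, orderOf_one] at hz
    exact (Fact.out : p.Prime).one_lt.ne hz
  have hTcomm : ∀ y, y ^ p ∈ Z → ∀ g, ⁅y, g⁆ ∈ T := by
    intro y hy g
    refine ⟨commutatorElement_mem_centralPowSeries hp hG hQ (Subgroup.mem_top _) g, ?_⟩
    have e1 : (g * y⁻¹ * g⁻¹) ^ p = (y ^ p)⁻¹ := by
      rw [conj_pow, inv_pow, Subgroup.mem_center_iff.1 (inv_mem hy) g]
      group
    have hn : g * y⁻¹ * g⁻¹ ∈ Subgroup.zpowers y ⊔ P := by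
      have h1 : ⁅g, y⁻¹⁆ ∈ P :=
        commutatorElement_mem_centralPowSeries hp hG hQ (Subgroup.mem_top _) y⁻¹
      have h2 := mul_mem (hPK y h1) (inv_mem (hyK y))
      rw [commutatorElement_def] at h2
      simpa using h2
    have e2 : ⁅y, g⁆ = y * (g * y⁻¹ * g⁻¹) := by rw [commutatorElement_def]; group
    rw [e2, (hsub y).mul_pow_of_mem (hyK y) hn hy (e1 ▸ inv_mem hy), e1, mul_inv_cancel]
  have root : ∀ {t u z : G} {n : ℕ}, t ^ p = 1 → z ∈ Z → t = u ^ p ^ n * z →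
      u ^ p ^ (n + 1) ∈ Z := by
    intro t u z n ht hz e
    have h1 : u ^ p ^ (n + 1) = (z ^ p)⁻¹ := by
      rw [eq_inv_iff_mul_eq_one, pow_succ p n, pow_mul,
        ← Commute.mul_pow (Subgroup.mem_center_iff.1 hz _), ← e, ht]
    rw [h1]
    exact inv_mem (pow_mem hz p)
  have hTT : ∀ s ∈ T, ∀ t ∈ T, Commute s t := by
    rintro s ⟨hs, hs'⟩ t ⟨ht, ht'⟩
    obtain ⟨v, z, hz, e⟩ := exists_eq_pow_mul_of_mem_centralPowSeries hp hG hQ hs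
    have h1 : v ^ p ^ 2 ∈ Z := root hs' hz e
    have h2 := (hsub v).commute_pow_of_mem (hyK v) (hPK v ht) h1 (ht' ▸ one_mem _)
    rw [e, pow_one]
    exact h2.mul_left (Subgroup.mem_center_iff.1 hz t).symm
  have hstep : ∀ m : ℕ, (∀ x y : G, x ^ p ^ (m + 2) ∈ Z → y ^ p ^ (m + 1) ∈ Z →
      Commute (x ^ p ^ (m + 1)) y) →
      ∀ x y : G, x ^ p ^ (m + 1) ∈ Z → y ^ p ^ m ∈ Z → Commute (x ^ p ^ m) y := by
    intro m hm x y hx hy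
    rcases m with _ | n
    · exact Subgroup.mem_center_iff.1 (by simpa using hy) _
    set a := x ^ p ^ n with ha
    have hap : a ^ p = x ^ p ^ (n + 1) := by rw [ha, ← pow_mul, ← pow_succ]
    have h1 : Commute (a : G ⧸ T) y := by
      refine (hquot T hT).commute_pow n x y ?_ ?_
      · rw [← QuotientGroup.mk_pow]
        exact mk_mem_center_iff.2 (hTcomm _ (by rwa [← pow_mul, ← pow_succ]))
      · rw [← QuotientGroup.mk_pow]
        exact mk_mem_center_iff.2 (hTcomm _ (by rwa [← pow_mul, ← pow_succ]))
    have hb : ⁅a⁻¹, y⁻¹⁆ ∈ T := by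
      rw [← QuotientGroup.eq_one_iff, ← QuotientGroup.mk'_apply, map_commutatorElement,
        commutatorElement_eq_one_iff_commute, map_inv, map_inv]
      exact h1.inv_inv
    have hb' : ⁅a⁻¹, y⁻¹⁆ ∈ centralPowSeries p G (n + 1) :=
      commutatorElement_mem_centralPowSeries hp hG hQ (inv_mem (pow_mem_centralPowSeries x n)) _
    set b := ⁅a⁻¹, y⁻¹⁆ with hbdef
    have ht : ⁅b⁻¹, a⁻¹⁆ ∈ T := by
      have h2 := mul_mem (inv_mem hb) (hTn.conj_mem b hb a⁻¹)
      rw [commutatorElement_def]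
      simpa [mul_assoc] using h2
    have ht' : ⁅b⁻¹, a⁻¹⁆ ∈ centralPowSeries p G (n + 2) :=
      commutatorElement_mem_centralPowSeries hp hG hQ (inv_mem hb') _
    have hba : b * a = a * b * ⁅b⁻¹, a⁻¹⁆ := by rw [commutatorElement_def]; group
    set t := ⁅b⁻¹, a⁻¹⁆
    obtain ⟨u, z, hz, e⟩ := exists_eq_pow_mul_of_mem_centralPowSeries hp hG hQ ht'
    have hta : Commute t a := by
      have h2 : Commute (u ^ p ^ (n + 2)) a := by
        refine hm u a (root ht.2 hz e) ?_
        rw [ha, ← pow_mul, mul_comm, pow_mul]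
        exact pow_mem hx _
      rw [e]
      exact h2.mul_left (Subgroup.mem_center_iff.1 hz a).symm
    have h3 := mul_pow_odd hp hba hta (hTT t ht b hb) (by rw [hb.2]; exact Commute.one_left a)
    have h4 : a * b = y⁻¹ * a * y⁻¹⁻¹ := by rw [hbdef, commutatorElement_def]; group
    rw [hb.2, mul_one, h4, conj_pow, hap] at h3
    have h5 : SemiconjBy y⁻¹ (x ^ p ^ (n + 1)) (x ^ p ^ (n + 1)) :=
      eq_mul_inv_iff_mul_eq.2 (by simpa using h3)
    exact (Commute.inv_left_iff.1 h5).symm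
  have hcomm : ∀ (m : ℕ) (x y : G), x ^ p ^ (m + 1) ∈ Z → y ^ p ^ m ∈ Z →
      Commute (x ^ p ^ m) y := by
    obtain ⟨e, he⟩ := IsPGroup.iff_card.1 hG
    have h1 : ∀ j m : ℕ, e ≤ m + j → ∀ x y : G, x ^ p ^ (m + 1) ∈ Z → y ^ p ^ m ∈ Z →
        Commute (x ^ p ^ m) y := by
      intro j
      induction j with
      | zero =>
        intro m hm x y _ _
        have h2 : x ^ p ^ m = 1 :=
          orderOf_dvd_iff_pow_eq_one.1
            ((orderOf_dvd_natCard x).trans (he ▸ pow_dvd_pow p (by simpa using hm)))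
        rw [h2]
        exact Commute.one_left y
      | succ j ih => exact fun m hm => hstep m (ih (m + 1) (by omega))
    exact fun m => h1 e m (by omega)
  refine ⟨hcomm, fun a b ha hb => ?_⟩
  have hba : b * a = a * b * ⁅b⁻¹, a⁻¹⁆ := by rw [commutatorElement_def]; group
  have ht : ⁅b⁻¹, a⁻¹⁆ ∈ T := hTcomm _ (by rw [inv_pow]; exact inv_mem hb) _
  set t := ⁅b⁻¹, a⁻¹⁆
  obtain ⟨u, z, hz, e⟩ := exists_eq_pow_mul_of_mem_centralPowSeries hp hG hQ ht.1
  have htc : ∀ g, g ^ p ∈ Z → Commute t g := by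
    intro g hg
    rw [e]
    exact (hcomm 1 u g (root ht.2 hz e) (by simpa using hg)).mul_left
      (Subgroup.mem_center_iff.1 hz g).symm
  exact mul_pow_odd hp hba (htc a ha) (htc b hb) (Subgroup.mem_center_iff.1 hb a).symm

theorem isPowerRegular_of_isQuasiPowerful {p : ℕ} [Fact p.Prime] (hp : Odd p) {G : Type*}
    [Group G] [Finite G] (hG : IsPGroup p G) (hQ : IsQuasiPowerful p G) : IsPowerRegular p G := by
  induction hn : Nat.card G using Nat.strong_induction_on generalizing G with
  | _ n ih =>
  subst hn
  by_cases hab : ∀ a b : G, Commute a b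
  · exact isPowerRegular_of_commute hab
  push Not at hab
  obtain ⟨a, b, hab⟩ := hab
  have : Nontrivial G := by
    by_contra h
    rw [not_nontrivial_iff_subsingleton] at h
    exact hab (Subsingleton.elim _ _)
  refine isPowerRegular_of_subgroup_of_quotient hp hG hQ (fun y => ?_) (fun N _ hN => ?_)
  · refine ih _ ?_ (hG.to_subgroup _) (isQuasiPowerful_zpowers_sup hp hG hQ y) rfl
    exact lt_of_le_of_ne (Subgroup.card_le_card_group _) fun h =>
      zpowers_sup_centralPowSeries_ne_top hG hab y (Subgroup.eq_top_of_card_eq _ h)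
  · refine ih _ ?_ (hG.to_quotient N) (hQ.quotient N) rfl
    rw [N.card_eq_card_quotient_mul_card_subgroup]
    exact lt_mul_of_one_lt_right Nat.card_pos ((Subgroup.one_lt_card_iff_ne_bot N).2 hN)

theorem omega_exponent (p : ℕ) (hp : p.Prime) (hodd : Odd p) (G : Type*) [Group G] [Finite G]
    (hG : IsPGroup p G) (hQP : IsQuasiPowerful p G) (i : ℕ) (a b : G)
    (ha : a ^ p ^ i = 1) (hb : b ^ p ^ i = 1) : (a * b) ^ p ^ i = 1 := by
  have := Fact.mk hp
  induction i generalizing G with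
  | zero => simp_all
  | succ i ih =>
    have hreg := isPowerRegular_of_isQuasiPowerful hodd hG hQP
    let N : Subgroup G :=
      { carrier := {t | t ^ p = 1}
        one_mem' := one_pow _
        inv_mem' := fun {t} (ht : t ^ p = 1) => by
          change t⁻¹ ^ p = 1
          rw [inv_pow, ht, inv_one]
        mul_mem' := fun {s t} (hs : s ^ p = 1) (ht : t ^ p = 1) => by
          change (s * t) ^ p = 1
          rw [hreg.mul_pow s t (hs ▸ one_mem _) (ht ▸ one_mem _), hs, ht, one_mul] }
    have hN : N.Normal := ⟨fun t (ht : t ^ p = 1) g => by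
      change (g * t * g⁻¹) ^ p = 1
      rw [conj_pow, ht, mul_one, mul_inv_cancel]⟩
    have hmem : ∀ c : G, c ^ p ^ (i + 1) = 1 ↔ (c : G ⧸ N) ^ p ^ i = 1 := by
      intro c
      rw [← QuotientGroup.mk_pow, QuotientGroup.eq_one_iff, pow_succ, pow_mul]
      rfl
    rw [hmem] at ha hb ⊢
    exact ih (G ⧸ N) (hG.to_quotient N) (hQP.quotient N) a b ha hb
end

section
/- Let p be an odd prime, let G be a quasi-powerful p-group and let i be a nonnegative integer. Then the index of G^{p^i} in G equals the cardinality of Ω_i(G), i.e. |G : G^{p^i}| = |Ω_i(G)|. -/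
open Subgroup
open scoped commutatorElement

section Commutators

variable {G : Type*} [Group G]

theorem pow_mul_eq_mul_pow_of_commute_commutator {a b : G}
    (ha : Commute ⁅a, b⁆ a) (n : ℕ) :
    a ^ n * b = ⁅a, b⁆ ^ n * (b * a ^ n) := by
  induction n with
  | zero => simp
  | succ n ih =>
    have h1 : a * b = ⁅a, b⁆ * (b * a) := by simp [commutatorElement_def]
    calc a ^ (n + 1) * b = a ^ n * (a * b) := by rw [pow_succ]; group
      _ = (a ^ n * ⁅a, b⁆) * (b * a) := by rw [h1]; group
      _ = ⁅a, b⁆ * (a ^ n * b) * a := by rw [← (ha.pow_right n).eq]; group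
      _ = ⁅a, b⁆ ^ (n + 1) * (b * a ^ (n + 1)) := by
        rw [ih, pow_succ a, pow_succ' ⁅a, b⁆]; simp only [mul_assoc]

theorem commutator_pow_left_of_commute {a b : G}
    (ha : Commute ⁅a, b⁆ a) (n : ℕ) :
    ⁅a ^ n, b⁆ = ⁅a, b⁆ ^ n := by
  rw [commutatorElement_def, pow_mul_eq_mul_pow_of_commute_commutator ha n]
  group

theorem mul_pow_choose_of_commute_commutator {a b : G}
    (ha : Commute ⁅a, b⁆ a) (hb : Commute ⁅a, b⁆ b) (n : ℕ) :
    a ^ n * b ^ n = ⁅a, b⁆ ^ n.choose 2 * (a * b) ^ n := by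
  induction n with
  | zero => simp
  | succ n ih =>
    have hab : Commute ⁅a, b⁆ (a * b) := ha.mul_right hb
    have h := pow_mul_eq_mul_pow_of_commute_commutator ha n
    calc a ^ (n + 1) * b ^ (n + 1) = a * (a ^ n * b) * b ^ n := by
          rw [pow_succ', pow_succ' b]; simp only [mul_assoc]
      _ = (a * ⁅a, b⁆ ^ n) * b * (a ^ n * b ^ n) := by rw [h]; simp only [mul_assoc]
      _ = ⁅a, b⁆ ^ n * ((a * b) * ⁅a, b⁆ ^ n.choose 2) * (a * b) ^ n := by
          rw [ih, ← (ha.pow_left n).eq]; simp only [mul_assoc]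
      _ = ⁅a, b⁆ ^ (n + 1).choose 2 * (a * b) ^ (n + 1) := by
          rw [← (hab.pow_left _).eq, Nat.choose_succ_succ' n 1, Nat.choose_one_right, pow_add,
            pow_succ' (a * b)]
          simp only [mul_assoc]

theorem mul_pow_prime_of_commute_commutator {p : ℕ} (hp : p.Prime) (hodd : Odd p) {a b : G}
    (ha : Commute ⁅a, b⁆ a) (hb : Commute ⁅a, b⁆ b) (he : ⁅a, b⁆ ^ p = 1) :
    (a * b) ^ p = a ^ p * b ^ p := by
  have h2 : 2 < p := lt_of_le_of_ne hp.two_le (by rintro rfl; exact absurd hodd (by decide))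
  obtain ⟨k, hk⟩ := hp.dvd_choose_self two_ne_zero h2
  rw [mul_pow_choose_of_commute_commutator ha hb, hk, pow_mul, he, one_pow, one_mul]

theorem commutator_pow_eq_one_of_commute {a b : G}
    (ha : Commute ⁅a, b⁆ a) {n : ℕ} (h : Commute (a ^ n) b) :
    ⁅a, b⁆ ^ n = 1 := by
  rw [← commutator_pow_left_of_commute ha, h.commutator_eq]

theorem commute_of_mem_center_left {a b : G} (h : a ∈ center G) : Commute a b :=
  (mem_center_iff.1 h b).symm

theorem conj_pow_eq {p : ℕ} (hp : p.Prime) (hodd : Odd p) {X Y : G}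
    (h1 : Commute ⁅⁅Y, X⁆, X⁆ ⁅Y, X⁆) (h2 : Commute ⁅⁅Y, X⁆, X⁆ X)
    (h3 : Commute (⁅Y, X⁆ ^ p) X) :
    Y * X ^ p * Y⁻¹ = ⁅Y, X⁆ ^ p * X ^ p := by
  rw [← mul_pow_prime_of_commute_commutator hp hodd h1 h2
    (commutator_pow_eq_one_of_commute h1 h3), ← conj_pow]
  congr 1
  simp [commutatorElement_def]

theorem mk_mem_center_of_commutator_le {M K : Subgroup G} [K.Normal]
    (h : ⁅M, (⊤ : Subgroup G)⁆ ≤ K) {m : G} (hm : m ∈ M) : (m : G ⧸ K) ∈ center (G ⧸ K) := by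
  rw [mem_center_iff]
  intro g
  induction g using QuotientGroup.induction_on with
  | H g =>
    have : (QuotientGroup.mk' K) ⁅m, g⁆ = 1 :=
      (QuotientGroup.eq_one_iff _).2 (h (commutator_mem_commutator hm (mem_top g)))
    rw [map_commutatorElement, commutatorElement_eq_one_iff_mul_comm] at this
    exact this.symm

theorem le_of_le_sup_commutator_top [Group.IsNilpotent G] {A B : Subgroup G} [A.Normal]
    (h : B ≤ A ⊔ ⁅B, (⊤ : Subgroup G)⁆) : B ≤ A := by
  set f := QuotientGroup.mk' A
  have hA : A.map f = ⊥ := by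
    rw [Subgroup.map_eq_bot_iff, QuotientGroup.ker_mk']
  have hB : B.map f ≤ ⁅B.map f, ⊤⁆ := by
    have := map_mono (f := f) h
    rwa [Subgroup.map_sup, hA, bot_sup_eq, map_commutator,
      map_top_of_surjective f (QuotientGroup.mk'_surjective A)] at this
  have hn : ∀ n, B.map f ≤ (⊤ : Subgroup (G ⧸ A)).lowerCentralSeries n := by
    intro n
    induction n with
    | zero => simp
    | succ n ih =>
      rw [Subgroup.lowerCentralSeries_succ]
      exact hB.trans (commutator_mono ih le_rfl)
  obtain ⟨n, hn'⟩ := Subgroup.nilpotent_iff_lowerCentralSeries.1 (inferInstance : Group.IsNilpotent (G ⧸ A))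
  have := hn n
  rw [hn', le_bot_iff, Subgroup.map_eq_bot_iff, QuotientGroup.ker_mk'] at this
  exact this

end Commutators

section PowerClosure

variable {G : Type*} [Group G]

/-- The subgroup generated by the `n`-th powers of the elements of `A`. -/
def powClosure (n : ℕ) (A : Subgroup G) : Subgroup G :=
  Subgroup.closure {x : G | ∃ a ∈ A, a ^ n = x}

theorem pow_mem_powClosure {n : ℕ} {A : Subgroup G} {a : G} (ha : a ∈ A) :
    a ^ n ∈ powClosure n A :=
  Subgroup.subset_closure ⟨a, ha, rfl⟩

theorem powClosure_le_iff {n : ℕ} {A B : Subgroup G} :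
    powClosure n A ≤ B ↔ ∀ a ∈ A, a ^ n ∈ B := by
  rw [powClosure, Subgroup.closure_le]
  exact ⟨fun h a ha => h ⟨a, ha, rfl⟩, by rintro h _ ⟨a, ha, rfl⟩; exact h a ha⟩

theorem powClosure_le (n : ℕ) (A : Subgroup G) : powClosure n A ≤ A :=
  powClosure_le_iff.2 fun _ ha => pow_mem ha n

theorem powClosure_mono (n : ℕ) {A B : Subgroup G} (h : A ≤ B) :
    powClosure n A ≤ powClosure n B :=
  powClosure_le_iff.2 fun _ ha => pow_mem_powClosure (h ha)

instance powClosure_normal (n : ℕ) (A : Subgroup G) [A.Normal] : (powClosure n A).Normal := by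
  refine ⟨fun x hx g => ?_⟩
  have h : powClosure n A ≤ (powClosure n A).comap (MulAut.conj g).toMonoidHom := by
    refine powClosure_le_iff.2 fun a ha => ?_
    have := pow_mem_powClosure (n := n) (‹A.Normal›.conj_mem a ha g)
    rwa [conj_pow] at this
  exact h hx

theorem powClosure_lt {p : ℕ} (hp : p.Prime) [Finite G] (hG : IsPGroup p G) {A : Subgroup G}
    (hA : A ≠ ⊥) : powClosure p A < A := by
  have : Fact p.Prime := ⟨hp⟩
  refine lt_of_le_of_ne (powClosure_le p A) fun h => ?_
  have : Nontrivial A := (Subgroup.nontrivial_iff_ne_bot A).2 hA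
  obtain ⟨n, hn0, hn⟩ := (hG.to_subgroup A).nontrivial_iff_card.1 this
  obtain ⟨K, hK⟩ := Sylow.exists_subgroup_card_pow_prime (G := A) p (n := n - 1)
    (hn ▸ pow_dvd_pow p (Nat.sub_le n 1))
  have hidx : K.index = p := by
    have h1 := K.card_mul_index
    rw [hK, hn, ← Nat.sub_add_cancel hn0, pow_succ, Nat.add_sub_cancel] at h1
    exact Nat.eq_of_mul_eq_mul_left (pow_pos hp.pos _) h1
  have : K.Normal := normal_of_index_eq_minFac_card (by
    rw [hidx, hn, hp.pow_minFac hn0.ne'])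
  have hle : A ≤ K.map A.subtype := by
    refine h.ge.trans (powClosure_le_iff.2 fun a ha => ⟨⟨a, ha⟩ ^ p, ?_, rfl⟩)
    rw [← hidx]
    exact K.pow_index_mem _
  have htop : K = ⊤ := by
    refine eq_top_iff.2 fun a _ => ?_
    obtain ⟨b, hb, hab⟩ := hle a.2
    rwa [← Subtype.ext hab]
  rw [htop, index_top] at hidx
  exact hp.one_lt.ne hidx

/-- A subgroup `B` of `G` is powerfully embedded if `[B,G] ≤ B^p`. -/
def IsPowerfullyEmbedded (p : ℕ) (B : Subgroup G) : Prop :=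
  ⁅B, (⊤ : Subgroup G)⁆ ≤ powClosure p B

theorem IsPowerfullyEmbedded.normal {p : ℕ} {B : Subgroup G} (h : IsPowerfullyEmbedded p B) :
    B.Normal :=
  commutator_top_right_le_iff.1 (h.trans (powClosure_le p B))

theorem commutator_mem_of_commute_mk {K : Subgroup G} [K.Normal] {x y : G}
    (h : Commute (x : G ⧸ K) (y : G ⧸ K)) : ⁅x, y⁆ ∈ K := by
  refine (QuotientGroup.eq_one_iff _).1 ?_
  change (QuotientGroup.mk' K) ⁅x, y⁆ = 1
  rwa [map_commutatorElement, commutatorElement_eq_one_iff_commute]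

theorem IsPowerfullyEmbedded.commutator_pow_mem {p : ℕ} (hp : p.Prime) (hodd : Odd p)
    {N : Subgroup G} (hN : IsPowerfullyEmbedded p N) {X Y : G} (h : ⁅Y, X⁆ ∈ N) :
    ⁅Y, X ^ p⁆ ∈ powClosure p N := by
  have := hN.normal
  apply commutator_mem_of_commute_mk
  have hmk : ((⁅Y, X⁆ : G) : G ⧸ powClosure p N) = ⁅(Y : G ⧸ powClosure p N), (X : G ⧸ _)⁆ :=
    map_commutatorElement (QuotientGroup.mk' (powClosure p N)) Y X
  have hc := mk_mem_center_of_commutator_le hN h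
  have hc1 : ((⁅Y, X⁆ : G) : G ⧸ powClosure p N) ^ p = 1 := by
    rw [← QuotientGroup.mk_pow, QuotientGroup.eq_one_iff]
    exact pow_mem_powClosure h
  rw [hmk] at hc hc1
  have he := (commute_of_mem_center_left (b := (X : G ⧸ powClosure p N)) hc).commutator_eq
  have := conj_pow_eq hp hodd (X := (X : G ⧸ powClosure p N)) (Y := Y)
    (by rw [he]; exact Commute.one_left _) (by rw [he]; exact Commute.one_left _)
    (by rw [hc1]; exact Commute.one_left _)
  rw [hc1, one_mul, mul_inv_eq_iff_eq_mul] at this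
  rw [QuotientGroup.mk_pow]
  exact this

theorem isPowerfullyEmbedded_of_le_sup_center {p : ℕ} (hp : p.Prime) (hodd : Odd p)
    [Group.IsNilpotent G] {R M : Subgroup G} [M.Normal] (hM : M ≤ powClosure p R ⊔ center G)
    (hR : ⁅R, (⊤ : Subgroup G)⁆ ≤ M) : IsPowerfullyEmbedded p M := by
  refine le_of_le_sup_commutator_top (commutator_le.2 ?_)
  set K := powClosure p M ⊔ ⁅⁅M, (⊤ : Subgroup G)⁆, (⊤ : Subgroup G)⁆ with hK
  have key : M ≤ (center (G ⧸ K)).comap (QuotientGroup.mk' K) := by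
    refine hM.trans (sup_le (powClosure_le_iff.2 fun r hr => ?_) fun z hz => ?_)
    · rw [mem_comap, mem_center_iff]
      intro g
      obtain ⟨g, rfl⟩ := QuotientGroup.mk'_surjective K g
      have hc : ⁅g, r⁆ ∈ M := by
        rw [← commutatorElement_inv]
        exact inv_mem (hR (commutator_mem_commutator hr (mem_top g)))
      set f := QuotientGroup.mk' K
      have hcp : ⁅f g, f r⁆ ^ p = 1 := by
        rw [← map_commutatorElement, ← map_pow]
        exact (QuotientGroup.eq_one_iff _).2 (le_sup_left (a := powClosure p M)
          (pow_mem_powClosure hc))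
      have he : ⁅⁅f g, f r⁆, f r⁆ ∈ center (G ⧸ K) := by
        rw [← map_commutatorElement, ← map_commutatorElement]
        exact mk_mem_center_of_commutator_le (M := ⁅M, (⊤ : Subgroup G)⁆) le_sup_right
          (commutator_mem_commutator hc (mem_top r))
      have := conj_pow_eq hp hodd (commute_of_mem_center_left he) (commute_of_mem_center_left he)
        (by rw [hcp]; exact Commute.one_left _)
      rw [hcp, one_mul, mul_inv_eq_iff_eq_mul] at this
      rw [map_pow]
      exact this
    · rw [mem_comap, mem_center_iff]
      intro g
      obtain ⟨g, rfl⟩ := QuotientGroup.mk'_surjective K g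
      rw [← map_mul, ← map_mul, mem_center_iff.1 hz g]
  intro m hm g _
  exact commutator_mem_of_commute_mk (commute_of_mem_center_left (key hm))

theorem IsPowerfullyEmbedded.powClosure {p : ℕ} (hp : p.Prime) (hodd : Odd p)
    [Group.IsNilpotent G] {B : Subgroup G} (hB : IsPowerfullyEmbedded p B) :
    IsPowerfullyEmbedded p (powClosure p B) := by
  have := hB.normal
  exact isPowerfullyEmbedded_of_le_sup_center hp hodd le_sup_left hB

end PowerClosure

section Fibres

variable {G : Type*} [Group G]

/-- For `g` in `G`, the map `a ↦ g⁻ᵖ(ga)ᵖ` takes every value in `A^p` equally often on `A`. -/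
def HasUniformPowFibres (p : ℕ) (g : G) (A : Subgroup G) : Prop :=
  ∀ d ∈ powClosure p A,
    Nat.card {a : A // (g * a) ^ p = g ^ p * d} * Nat.card (powClosure p A) = Nat.card A

theorem HasUniformPowFibres.exists_pow_eq {p : ℕ} [Finite G] {g : G} {A : Subgroup G}
    (h : HasUniformPowFibres p g A) {d : G} (hd : d ∈ powClosure p A) :
    ∃ a ∈ A, (g * a) ^ p = g ^ p * d := by
  have h1 := h d hd
  have h2 : Nat.card {a : A // (g * a) ^ p = g ^ p * d} ≠ 0 := by
    intro h0
    rw [h0, zero_mul] at h1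
    exact Nat.card_pos.ne h1
  obtain ⟨⟨⟨a, ha⟩, hga⟩⟩ := (Nat.card_ne_zero.1 h2).1
  exact ⟨a, ha, hga⟩

theorem hasUniformPowFibres_bot (p : ℕ) (g : G) : HasUniformPowFibres p g (⊥ : Subgroup G) := by
  intro d hd
  have hbot : powClosure p (⊥ : Subgroup G) = ⊥ := le_bot_iff.1 (powClosure_le p ⊥)
  rw [hbot, mem_bot] at hd
  subst hd
  rw [hbot]
  have : Unique {a : (⊥ : Subgroup G) // (g * a) ^ p = g ^ p * 1} :=
    { default := ⟨1, by simp⟩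
      uniq := fun a => Subsingleton.elim _ _ }
  simp

theorem card_fibre_mul_card_range {A Q : Type*} [Group A] [Group Q] [Finite A] (f : A →* Q) {q : Q}
    (hq : q ∈ f.range) : Nat.card {a // f a = q} * Nat.card f.range = Nat.card A := by
  obtain ⟨a₀, rfl⟩ := hq
  rw [← index_ker, ← f.ker.card_mul_index]
  congr 1
  refine Nat.card_congr
    { toFun := fun a => ⟨a₀⁻¹ * a.1, by simp [MonoidHom.mem_ker, a.2]⟩
      invFun := fun k => ⟨a₀ * k.1, by simp [(MonoidHom.mem_ker).1 k.2]⟩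
      left_inv := fun a => by simp
      right_inv := fun k => by simp }

theorem mk_mul_pow {p : ℕ} (hp : p.Prime) (hodd : Odd p) {B : Subgroup G} [(powClosure p B).Normal]
    (hB : IsPowerfullyEmbedded p B) {x y : G} (h : ⁅x, y⁆ ∈ B) :
    (((x * y) ^ p : G) : G ⧸ powClosure p B) = ((x ^ p : G) : G ⧸ powClosure p B) * (y ^ p : G) := by
  have hc := mk_mem_center_of_commutator_le hB h
  have hmk : ((⁅x, y⁆ : G) : G ⧸ powClosure p B) = ⁅(x : G ⧸ powClosure p B), (y : G ⧸ _)⁆ :=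
    map_commutatorElement (QuotientGroup.mk' (powClosure p B)) x y
  have hc1 : ((⁅x, y⁆ : G) : G ⧸ powClosure p B) ^ p = 1 := by
    rw [← QuotientGroup.mk_pow, QuotientGroup.eq_one_iff]
    exact pow_mem_powClosure h
  rw [hmk] at hc hc1
  exact mul_pow_prime_of_commute_commutator hp hodd (commute_of_mem_center_left hc)
    (commute_of_mem_center_left hc) hc1

theorem HasUniformPowFibres.of_subgroup {p : ℕ} (hp : p.Prime) (hodd : Odd p) [Finite G] {g : G}
    {A B : Subgroup G} (hBA : B ≤ A) (hB : IsPowerfullyEmbedded p B) (hAB : ⁅A, A⁆ ≤ B)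
    (hg : ∀ a ∈ A, ⁅g, a⁆ ∈ B) (hU : ∀ a ∈ A, HasUniformPowFibres p (g * a) B) :
    HasUniformPowFibres p g A := by
  intro d hd
  have := hB.normal
  set C := powClosure p B with hC
  let θ : A →* G ⧸ C :=
    { toFun := fun a => ((a.1 ^ p : G) : G ⧸ C)
      map_one' := by simp
      map_mul' := fun a b =>
        mk_mul_pow hp hodd hB (hAB (commutator_mem_commutator a.2 b.2)) }
  let ψ : powClosure p A →* G ⧸ C := (QuotientGroup.mk' C).comp (powClosure p A).subtype
  have hCA : C ≤ powClosure p A := powClosure_mono p hBA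
  have hrange : ψ.range = θ.range := by
    apply le_antisymm
    · have : powClosure p A ≤ θ.range.comap (QuotientGroup.mk' C) :=
        powClosure_le_iff.2 fun a ha => ⟨⟨a, ha⟩, rfl⟩
      rintro _ ⟨x, rfl⟩
      exact this x.2
    · rintro _ ⟨a, rfl⟩
      exact ⟨⟨a.1 ^ p, pow_mem_powClosure a.2⟩, rfl⟩
  have hker : Nat.card {x // ψ x = 1} = Nat.card C :=
    Nat.card_congr
      { toFun := fun x => ⟨x.1.1, (QuotientGroup.eq_one_iff _).1 x.2⟩
        invFun := fun c => ⟨⟨c.1, hCA c.2⟩, (QuotientGroup.eq_one_iff _).2 c.2⟩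
        left_inv := fun _ => rfl
        right_inv := fun _ => rfl }
  have hψ := card_fibre_mul_card_range ψ (one_mem _)
  have hθ := card_fibre_mul_card_range θ (q := ψ ⟨d, hd⟩) (hrange ▸ ⟨_, rfl⟩)
  rw [hker, hrange] at hψ
  have hpairs : Nat.card {ab : A × B // (g * ab.1 * ab.2) ^ p = g ^ p * d} =
      Nat.card {a : A // (g * a) ^ p = g ^ p * d} * Nat.card B := by
    rw [← Nat.card_prod]
    refine Nat.card_congr
      { toFun := fun x => ⟨⟨⟨x.1.1 * x.1.2, mul_mem x.1.1.2 (hBA x.1.2.2)⟩, ?_⟩, x.1.2⟩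
        invFun := fun y => ⟨⟨⟨y.1.1 * (y.2 : G)⁻¹, mul_mem y.1.1.2 (inv_mem (hBA y.2.2))⟩, y.2⟩, ?_⟩
        left_inv := ?_
        right_inv := ?_ }
    · simpa [mul_assoc] using x.2
    · simpa [mul_assoc] using y.1.2
    · rintro ⟨⟨a, b⟩, h⟩; simp
    · rintro ⟨⟨a, h⟩, b⟩; simp
  have hga (a : A) : (((g * a) ^ p : G) : G ⧸ C) = ((g ^ p : G) : G ⧸ C) * θ a :=
    mk_mul_pow hp hodd hB (hg a a.2)
  have hpairs' : Nat.card {ab : A × B // (g * ab.1 * ab.2) ^ p = g ^ p * d} * Nat.card C =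
      Nat.card {a // θ a = ψ ⟨d, hd⟩} * Nat.card B := by
    have hmem : ∀ x : {ab : A × B // (g * ab.1 * ab.2) ^ p = g ^ p * d}, θ x.1.1 = ψ ⟨d, hd⟩ := by
      rintro ⟨⟨a, b⟩, h⟩
      have hcomm : ⁅g * a, (b : G)⁆ ∈ B := by
        rw [← commutatorElement_inv]
        exact inv_mem (commutator_top_right_le_iff.2 hB.normal
          (commutator_mem_commutator b.2 (mem_top _)))
      have h1 := mk_mul_pow hp hodd hB hcomm
      rw [h, hga, QuotientGroup.mk_mul,
        (QuotientGroup.eq_one_iff _).2 (pow_mem_powClosure b.2), mul_one] at h1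
      exact (mul_left_cancel h1).symm
    have e : {ab : A × B // (g * ab.1 * ab.2) ^ p = g ^ p * d} ≃
        Σ a : {a // θ a = ψ ⟨d, hd⟩}, {b : B // (g * a.1 * b) ^ p = g ^ p * d} :=
      { toFun := fun x => ⟨⟨x.1.1, hmem x⟩, ⟨x.1.2, x.2⟩⟩
        invFun := fun y => ⟨⟨y.1.1, y.2.1⟩, y.2.2⟩
        left_inv := fun _ => rfl
        right_inv := fun _ => rfl }
    have := Fintype.ofFinite {a // θ a = ψ ⟨d, hd⟩}
    rw [Nat.card_congr e, Nat.card_sigma, Finset.sum_mul,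
      Nat.card_eq_fintype_card (α := {a // θ a = ψ ⟨d, hd⟩}), ← Finset.card_univ]
    refine Finset.sum_const_nat fun a _ => ?_
    have hc : ((g * a.1) ^ p)⁻¹ * (g ^ p * d) ∈ C := by
      rw [← QuotientGroup.eq, hga, a.2]
      rfl
    have := hU a.1 a.1.2 _ hc
    rwa [mul_inv_cancel_left] at this
  have hBpos : 0 < Nat.card B := Nat.card_pos
  rw [hpairs] at hpairs'
  have h1 : Nat.card {a : A // (g * a) ^ p = g ^ p * d} * Nat.card C =
      Nat.card {a // θ a = ψ ⟨d, hd⟩} := by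
    refine Nat.eq_of_mul_eq_mul_right hBpos ?_
    rw [← hpairs']; ring
  rw [← hψ, ← hθ, ← h1, mul_assoc]

theorem IsPowerfullyEmbedded.hasUniformPowFibres {p : ℕ} (hp : p.Prime) (hodd : Odd p) [Finite G]
    (hG : IsPGroup p G) {B : Subgroup G} (hB : IsPowerfullyEmbedded p B) (g : G) :
    HasUniformPowFibres p g B := by
  have : Fact p.Prime := ⟨hp⟩
  have := hG.isNilpotent
  induction hn : Nat.card B using Nat.strong_induction_on generalizing B g with
  | _ n ih =>
    by_cases hbot : B = ⊥
    · subst hbot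
      exact hasUniformPowFibres_bot p g
    · have hlt := powClosure_lt hp hG hbot
      have hcard : Nat.card (_root_.powClosure p B) < n := by
        rw [← hn]
        exact Set.Finite.card_lt_card (Set.toFinite _) hlt
      have hC := hB.powClosure hp hodd
      refine HasUniformPowFibres.of_subgroup hp hodd hlt.le hC ?_ ?_ ?_
      · exact (commutator_mono le_rfl le_top).trans hB
      · intro a ha
        rw [← commutatorElement_inv]
        exact inv_mem (hB (commutator_mem_commutator ha (mem_top g)))
      · exact fun a _ => ih _ hcard hC (g * a) rfl

theorem hasUniformPowFibres_one {p : ℕ} (hp : p.Prime) (hodd : Odd p) [Finite G]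
    (hG : IsPGroup p G) {A B : Subgroup G} (hBA : B ≤ A) (hB : IsPowerfullyEmbedded p B)
    (hAB : ⁅A, A⁆ ≤ B) : HasUniformPowFibres p 1 A :=
  HasUniformPowFibres.of_subgroup hp hodd hBA hB hAB (by simp)
    fun a _ => hB.hasUniformPowFibres hp hodd hG _

end Fibres

section Series

variable {G : Type*} [Group G]

/-- The commutator subgroup of `G` is contained in `G^p Z(G)`. -/
def CommutatorLePowCenter (p : ℕ) (G : Type*) [Group G] : Prop :=
  ⁅(⊤ : Subgroup G), (⊤ : Subgroup G)⁆ ≤ powClosure p ⊤ ⊔ center G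

theorem IsQuasiPowerful.commutatorLePowCenter {p : ℕ} (h : IsQuasiPowerful p G) :
    CommutatorLePowCenter p G := by
  have h1 : powSubgroup (G ⧸ center G) p ≤
      (powClosure p (⊤ : Subgroup G)).map (QuotientGroup.mk' (center G)) := by
    rw [powSubgroup, Subgroup.closure_le]
    rintro _ ⟨g, rfl⟩
    obtain ⟨g, rfl⟩ := QuotientGroup.mk'_surjective (center G) g
    exact ⟨g ^ p, pow_mem_powClosure (mem_top g), map_pow _ _ _⟩
  refine commutator_le.2 fun a _ b _ => ?_
  have h2 := h.trans h1 (commutator_mem_commutator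
    (mem_top (QuotientGroup.mk' (center G) a)) (mem_top (QuotientGroup.mk' (center G) b)))
  rw [← map_commutatorElement, ← mem_comap, comap_map_eq, QuotientGroup.ker_mk'] at h2
  exact h2

theorem CommutatorLePowCenter.quotient {p : ℕ} (h : CommutatorLePowCenter p G) (K : Subgroup G)
    [K.Normal] : CommutatorLePowCenter p (G ⧸ K) := by
  have h1 : powClosure p ⊤ ⊔ center G ≤
      (powClosure p (⊤ : Subgroup (G ⧸ K)) ⊔ center (G ⧸ K)).comap (QuotientGroup.mk' K) := by
    refine sup_le (powClosure_le_iff.2 fun a _ => ?_) fun z hz => ?_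
    · rw [mem_comap, map_pow]
      exact le_sup_left (a := powClosure p (⊤ : Subgroup (G ⧸ K))) (pow_mem_powClosure (mem_top _))
    · refine le_sup_right (b := center (G ⧸ K)) (mem_center_iff.2 fun g => ?_)
      obtain ⟨g, rfl⟩ := QuotientGroup.mk'_surjective K g
      rw [← map_mul, ← map_mul, mem_center_iff.1 hz g]
  refine commutator_le.2 fun a _ b _ => ?_
  obtain ⟨a, rfl⟩ := QuotientGroup.mk'_surjective K a
  obtain ⟨b, rfl⟩ := QuotientGroup.mk'_surjective K b
  rw [← map_commutatorElement]
  exact h1 (h (commutator_mem_commutator (mem_top a) (mem_top b)))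

/-- Iterated `p`-th power subgroups, starting from `A`. -/
def iteratedPowClosure (p : ℕ) (A : Subgroup G) : ℕ → Subgroup G
  | 0 => A
  | k + 1 => powClosure p (iteratedPowClosure p A k)

theorem iteratedPowClosure_mono (p : ℕ) {A B : Subgroup G} (h : A ≤ B) (k : ℕ) :
    iteratedPowClosure p A k ≤ iteratedPowClosure p B k := by
  induction k with
  | zero => exact h
  | succ k ih => exact powClosure_mono p ih

theorem iteratedPowClosure_antitone (p : ℕ) (A : Subgroup G) :
    Antitone (iteratedPowClosure p A) :=
  antitone_nat_of_succ_le fun _ => powClosure_le p _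

theorem pow_mem_iteratedPowClosure_top (p : ℕ) (x : G) (k : ℕ) :
    x ^ p ^ k ∈ iteratedPowClosure p (⊤ : Subgroup G) k := by
  induction k with
  | zero => exact mem_top _
  | succ k ih =>
    rw [pow_succ, pow_mul]
    exact pow_mem_powClosure ih

/-- The series `(G^p Z(G))^{p^k}`. -/
def powCenterSeries (p : ℕ) (G : Type*) [Group G] : ℕ → Subgroup G :=
  iteratedPowClosure p (powClosure p ⊤ ⊔ center G)

theorem CommutatorLePowCenter.isPowerfullyEmbedded {p : ℕ} (hp : p.Prime) (hodd : Odd p)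
    [Group.IsNilpotent G] (h : CommutatorLePowCenter p G) (k : ℕ) :
    IsPowerfullyEmbedded p (powCenterSeries p G k) := by
  induction k with
  | zero =>
    exact isPowerfullyEmbedded_of_le_sup_center hp hodd (R := ⊤)
      (M := powClosure p ⊤ ⊔ center G) le_rfl h
  | succ k ih => exact ih.powClosure hp hodd

theorem CommutatorLePowCenter.commutator_pow_pow_mem {p : ℕ} (hp : p.Prime) (hodd : Odd p)
    [Group.IsNilpotent G] (h : CommutatorLePowCenter p G) (x y : G) (j k : ℕ) :
    ⁅x ^ p ^ j, y ^ p ^ k⁆ ∈ powCenterSeries p G (j + k) := by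
  induction k with
  | zero =>
    rw [pow_zero, pow_one, add_zero, ← commutatorElement_inv]
    refine inv_mem ?_
    induction j with
    | zero =>
      rw [pow_zero, pow_one]
      exact h (commutator_mem_commutator (mem_top y) (mem_top x))
    | succ j ih =>
      rw [pow_succ, pow_mul]
      exact (h.isPowerfullyEmbedded hp hodd j).commutator_pow_mem hp hodd ih
  | succ k ih =>
    rw [pow_succ p k, pow_mul]
    exact (h.isPowerfullyEmbedded hp hodd (j + k)).commutator_pow_mem hp hodd ih

theorem CommutatorLePowCenter.exists_eq_pow_mul {p : ℕ} (hp : p.Prime) (hodd : Odd p)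
    [Finite G] (hG : IsPGroup p G) (h : CommutatorLePowCenter p G) (k : ℕ) {n : G}
    (hn : n ∈ powCenterSeries p G k) : ∃ w, ∃ z ∈ center G, n = w ^ p ^ (k + 1) * z := by
  have : Fact p.Prime := ⟨hp⟩
  have := hG.isNilpotent
  have hN := h.isPowerfullyEmbedded hp hodd
  induction k generalizing n with
  | zero =>
    obtain ⟨d, hd, z, hz, rfl⟩ := mem_sup_of_normal_right.1 hn
    have hU : HasUniformPowFibres p 1 (⊤ : Subgroup G) :=
      hasUniformPowFibres_one hp hodd hG le_top (hN 0) h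
    obtain ⟨w, -, hw⟩ := hU.exists_pow_eq hd
    refine ⟨w, z, hz, ?_⟩
    simpa using hw.symm
  | succ k ih =>
    obtain ⟨m, hm, hmn⟩ := ((hN k).hasUniformPowFibres hp hodd hG 1).exists_pow_eq hn
    obtain ⟨w, z, hz, rfl⟩ := ih hm
    refine ⟨w, z ^ p, pow_mem hz p, ?_⟩
    rw [one_mul, one_pow, one_mul, ← (commute_of_mem_center_left hz).eq,
      (commute_of_mem_center_left hz).mul_pow, (commute_of_mem_center_left (pow_mem hz p)).eq,
      ← pow_mul, ← pow_succ] at hmn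
    exact hmn.symm

theorem CommutatorLePowCenter.card_pow_eq_mul_card {p : ℕ} (hp : p.Prime) (hodd : Odd p)
    [Finite G] (hG : IsPGroup p G) (h : CommutatorLePowCenter p G) (i : ℕ) {w : G}
    (hw : w ∈ iteratedPowClosure p ⊤ i) :
    Nat.card {x : G // x ^ p ^ i = w} * Nat.card (iteratedPowClosure p (⊤ : Subgroup G) i) =
      Nat.card G := by
  have : Fact p.Prime := ⟨hp⟩
  have := hG.isNilpotent
  induction i generalizing w with
  | zero =>
    have : Unique {x : G // x ^ p ^ 0 = w} :=
      { default := ⟨w, by simp⟩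
        uniq := fun x => Subtype.ext (by simpa using x.2) }
    rw [Nat.card_unique, one_mul]
    exact card_top
  | succ i ih =>
    set H := iteratedPowClosure p (⊤ : Subgroup G) i with hH
    have hroot : ∀ v ∈ H, ∃ x : G, x ^ p ^ i = v := by
      intro v hv
      have h1 := ih hv
      have h2 : Nat.card {x : G // x ^ p ^ i = v} ≠ 0 := by
        intro h0
        rw [h0, zero_mul] at h1
        exact Nat.card_pos.ne h1
      obtain ⟨⟨x, hx⟩⟩ := (Nat.card_ne_zero.1 h2).1
      exact ⟨x, hx⟩
    have hU : HasUniformPowFibres p 1 H := by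
      refine hasUniformPowFibres_one hp hodd hG (iteratedPowClosure_mono p le_top i)
        (h.isPowerfullyEmbedded hp hodd i) (commutator_le.2 fun a ha b hb => ?_)
      obtain ⟨x, rfl⟩ := hroot a ha
      obtain ⟨y, rfl⟩ := hroot b hb
      exact iteratedPowClosure_antitone p _ (Nat.le_add_right i i)
        (h.commutator_pow_pow_mem hp hodd x y i i)
    have e : {x : G // x ^ p ^ (i + 1) = w} ≃
        Σ v : {v : H // (1 * v : G) ^ p = 1 ^ p * w}, {x : G // x ^ p ^ i = v.1} :=
      { toFun := fun x => ⟨⟨⟨x.1 ^ p ^ i, pow_mem_iteratedPowClosure_top p x.1 i⟩, by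
          rw [one_mul, one_pow, one_mul, ← pow_mul, ← pow_succ, x.2]⟩, ⟨x.1, rfl⟩⟩
        invFun := fun y => ⟨y.2.1, by
          rw [pow_succ, pow_mul, y.2.2]
          simpa using y.1.2⟩
        left_inv := fun _ => rfl
        right_inv := by
          rintro ⟨⟨⟨v, hv⟩, hvw⟩, ⟨x, (rfl : x ^ p ^ i = v)⟩⟩
          rfl }
    have hsum : Nat.card {x : G // x ^ p ^ (i + 1) = w} * Nat.card H =
        Nat.card {v : H // (1 * v : G) ^ p = 1 ^ p * w} * Nat.card G := by
      have := Fintype.ofFinite {v : H // (1 * v : G) ^ p = 1 ^ p * w}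
      rw [Nat.card_congr e, Nat.card_sigma, Finset.sum_mul,
        Nat.card_eq_fintype_card (α := {v : H // (1 * v : G) ^ p = 1 ^ p * w}),
        ← Finset.card_univ]
      exact Finset.sum_const_nat fun v _ => ih v.1.2
    have hcard := hU w hw
    have hpos : 0 < Nat.card H := Nat.card_pos
    refine Nat.eq_of_mul_eq_mul_right hpos ?_
    change _ * Nat.card (powClosure p H) * _ = _
    rw [mul_right_comm, hsum, mul_right_comm, hcard, mul_comm]

theorem CommutatorLePowCenter.card_pow_eq_one {p : ℕ} (hp : p.Prime) (hodd : Odd p)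
    [Finite G] (hG : IsPGroup p G) (h : CommutatorLePowCenter p G) (i : ℕ) :
    (powSubgroup G (p ^ i)).index = Nat.card {x : G // x ^ p ^ i = 1} := by
  have hcard {w : G} (hw : w ∈ iteratedPowClosure p ⊤ i) := h.card_pow_eq_mul_card hp hodd hG i hw
  have heq : powSubgroup G (p ^ i) = iteratedPowClosure p ⊤ i := by
    apply le_antisymm
    · rw [powSubgroup, Subgroup.closure_le]
      rintro _ ⟨g, rfl⟩
      exact pow_mem_iteratedPowClosure_top p g i
    · intro w hw
      have h2 : Nat.card {x : G // x ^ p ^ i = w} ≠ 0 := by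
        intro h0
        have h1 := hcard hw
        rw [h0, zero_mul] at h1
        exact Nat.card_pos.ne h1
      exact Subgroup.subset_closure (by simpa using (Nat.card_ne_zero.1 h2).1)
  rw [heq]
  refine Nat.eq_of_mul_eq_mul_right (Nat.card_pos (α := iteratedPowClosure p (⊤ : Subgroup G) i)) ?_
  rw [hcard (one_mem _), index_mul_card]

end Series

section Torsion

/-- The elements with trivial `n`-th power form a subgroup if they are closed under products. -/
def rootSubgroup {G : Type*} [Group G] (n : ℕ)
    (h : ∀ a b : G, a ^ n = 1 → b ^ n = 1 → (a * b) ^ n = 1) : Subgroup G where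
  carrier := {x | x ^ n = 1}
  mul_mem' := h _ _
  one_mem' := one_pow n
  inv_mem' := fun {x} (hx : x ^ n = 1) => by simp [hx]

theorem mem_rootSubgroup {G : Type*} [Group G] {n : ℕ}
    {h : ∀ a b : G, a ^ n = 1 → b ^ n = 1 → (a * b) ^ n = 1} {x : G} :
    x ∈ rootSubgroup n h ↔ x ^ n = 1 :=
  Iff.rfl

theorem rootSubgroup_normal {G : Type*} [Group G] {n : ℕ}
    (h : ∀ a b : G, a ^ n = 1 → b ^ n = 1 → (a * b) ^ n = 1) : (rootSubgroup n h).Normal :=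
  ⟨fun x (hx : x ^ n = 1) g => mem_rootSubgroup.2 (by simp [conj_pow, hx])⟩

/-- The elements of order dividing a given power of `p` are closed under products. -/
def TorsionClosed (p : ℕ) (G : Type*) [Group G] : Prop :=
  ∀ (i : ℕ) (a b : G), a ^ p ^ i = 1 → b ^ p ^ i = 1 → (a * b) ^ p ^ i = 1

/-- Powers of `x` and `y` with complementary exponents commute when suitable powers of `x` and `y`
are central. -/
def PowersCommute (p : ℕ) (G : Type*) [Group G] (i : ℕ) : Prop :=
  ∀ x y : G, x ^ p ^ (i + 1) ∈ center G → y ^ p ^ i ∈ center G →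
    ∀ j k, j + k = i → Commute (x ^ p ^ j) (y ^ p ^ k)

variable {G : Type*} [Group G]

theorem pow_mem_center_of_le {p m n : ℕ} (hmn : m ≤ n) {x : G} (h : x ^ p ^ m ∈ center G) :
    x ^ p ^ n ∈ center G := by
  obtain ⟨k, rfl⟩ := Nat.exists_eq_add_of_le hmn
  rw [pow_add, pow_mul]
  exact pow_mem h _

theorem CommutatorLePowCenter.powersCommute_of_succ {p : ℕ} (hp : p.Prime) (hodd : Odd p)
    [Finite G] (hG : IsPGroup p G) (hC : CommutatorLePowCenter p G) {D : Subgroup G} [D.Normal]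
    (hD : ∀ x, x ∈ D ↔ x ^ p ∈ center G) {i : ℕ}
    (hQ : ∀ i', i' + 1 = i → PowersCommute p (G ⧸ D) i')
    (hP : ∀ v h : G, v ^ p ^ (i + 2) ∈ center G → h ^ p ^ (i + 1) ∈ center G →
      Commute (v ^ p ^ (i + 1)) h) : PowersCommute p G i := by
  have : Fact p.Prime := ⟨hp⟩
  have := hG.isNilpotent
  intro x y hx hy j
  induction j with
  | zero =>
    rintro k hk
    rw [zero_add] at hk
    subst hk
    exact (commute_of_mem_center_left hy).symm
  | succ j ih =>
    intro k hk
    obtain rfl : i = j + k + 1 := by omega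
    have hXY := ih (k + 1) (by omega)
    set X := x ^ p ^ j with hX
    set Y := y ^ p ^ k with hY
    have hXc : X ^ p ^ (j + k + 1 + 1) ∈ center G := by
      rw [hX, ← pow_mul, mul_comm, pow_mul]
      exact pow_mem hx _
    have hYc : Y ^ p ^ (j + k + 1 + 1) ∈ center G := by
      rw [hY, ← pow_mul, mul_comm, pow_mul]
      exact pow_mem (pow_mem_center_of_le (Nat.le_succ _) hy) _
    have hcD : ⁅X, Y⁆ ∈ D := by
      apply commutator_mem_of_commute_mk
      have h1 : ((x : G ⧸ D)) ^ p ^ (j + k + 1) ∈ center (G ⧸ D) := by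
        rw [← QuotientGroup.mk_pow, (QuotientGroup.eq_one_iff _).2 ((hD _).2 _)]
        · exact one_mem _
        · rwa [← pow_mul, ← pow_succ]
      have h2 : ((y : G ⧸ D)) ^ p ^ (j + k) ∈ center (G ⧸ D) := by
        rw [← QuotientGroup.mk_pow, (QuotientGroup.eq_one_iff _).2 ((hD _).2 _)]
        · exact one_mem _
        · rwa [← pow_mul, ← pow_succ]
      exact hQ (j + k) rfl _ _ h1 h2 j k rfl
    have hcN : ⁅X, Y⁆ ∈ powCenterSeries p G (j + k) := hC.commutator_pow_pow_mem hp hodd x y j k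
    have key : ∀ c ∈ D, c ∈ powCenterSeries p G (j + k) → ∀ g h : G,
        h ^ p ^ (j + k + 1 + 1) ∈ center G → Commute ⁅c, g⁆ h := by
      intro c hc hcN g h hh
      have h1 : ⁅c, g⁆ ∈ D :=
        commutator_top_right_le_iff.2 ‹D.Normal› (commutator_mem_commutator hc (mem_top g))
      have h2 : ⁅c, g⁆ ∈ powCenterSeries p G (j + k + 1) :=
        hC.isPowerfullyEmbedded hp hodd (j + k) (commutator_mem_commutator hcN (mem_top g))
      obtain ⟨v, z, hz, hv⟩ := hC.exists_eq_pow_mul hp hodd hG _ h2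
      rw [hv, hD, (commute_of_mem_center_left hz).symm.mul_pow, ← pow_mul, ← pow_succ,
        mul_mem_cancel_right (pow_mem hz p)] at h1
      rw [hv]
      exact (hP v h h1 hh).mul_left (commute_of_mem_center_left hz)
    have hDc : ∀ c ∈ D, c ^ p ^ (j + k + 1 + 1) ∈ center G := fun c hc =>
      pow_mem_center_of_le (m := 1) (by omega) (by rw [pow_one]; exact (hD c).1 hc)
    have hcD' : ⁅Y, X⁆ ∈ D := by rw [← commutatorElement_inv]; exact inv_mem hcD
    have hcN' : ⁅Y, X⁆ ∈ powCenterSeries p G (j + k) := by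
      rw [← commutatorElement_inv]; exact inv_mem hcN
    have e1 := conj_pow_eq hp hodd (key _ hcD' hcN' X _ (hDc _ hcD'))
      (key _ hcD' hcN' X _ hXc) (commute_of_mem_center_left ((hD _).1 hcD'))
    have e2 := conj_pow_eq hp hodd (key _ hcD hcN Y _ (hDc _ hcD))
      (key _ hcD hcN Y _ hYc) (commute_of_mem_center_left ((hD _).1 hcD))
    rw [pow_succ p k, pow_mul, ← hY] at hXY
    rw [hXY.eq, mul_inv_cancel_right] at e2
    have hcp : ⁅Y, X⁆ ^ p = 1 := by
      rw [← commutatorElement_inv, inv_pow, inv_eq_one]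
      exact right_eq_mul.1 e2
    rw [hcp, one_mul, mul_inv_eq_iff_eq_mul] at e1
    rw [pow_succ p j, pow_mul, ← hX]
    exact e1.symm

theorem CommutatorLePowCenter.powersCommute {p : ℕ} (hp : p.Prime) (hodd : Odd p)
    [Finite G] (hG : IsPGroup p G) (hC : CommutatorLePowCenter p G) {D : Subgroup G} [D.Normal]
    (hD : ∀ x, x ∈ D ↔ x ^ p ∈ center G) (hQ : ∀ i, PowersCommute p (G ⧸ D) i) (i : ℕ) :
    PowersCommute p G i := by
  have : Fact p.Prime := ⟨hp⟩
  obtain ⟨m, hm⟩ := IsPGroup.iff_card.1 hG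
  have hP : ∀ d i, m ≤ i + d → ∀ x y : G, x ^ p ^ (i + 1) ∈ center G → y ^ p ^ i ∈ center G →
      Commute (x ^ p ^ i) y := by
    intro d
    induction d with
    | zero =>
      intro i hi x y _ _
      obtain ⟨k, rfl⟩ := Nat.exists_eq_add_of_le hi
      rw [pow_add, pow_mul, ← hm, pow_card_eq_one', one_pow]
      exact Commute.one_left y
    | succ d ih =>
      intro i hi x y hx hy
      have := hC.powersCommute_of_succ hp hodd hG hD (fun i' _ => hQ i') (ih (i + 1) (by omega))
        x y hx hy i 0 (add_zero i)
      rwa [pow_zero, pow_one] at this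
  exact hC.powersCommute_of_succ hp hodd hG hD (fun i' _ => hQ i') (hP m (i + 1) (by omega))

theorem CommutatorLePowCenter.mul_pow_eq_one {p : ℕ} (hp : p.Prime) (hodd : Odd p)
    [Finite G] (hG : IsPGroup p G) (hC : CommutatorLePowCenter p G) {D : Subgroup G} [D.Normal]
    (hD : ∀ x, x ∈ D ↔ x ^ p ∈ center G) (hQ : PowersCommute p G 1) (t s : G)
    (ht : t ^ p = 1) (hs : s ^ p = 1) : (t * s) ^ p = 1 := by
  have hcD : ⁅t, s⁆ ∈ D := commutator_top_right_le_iff.2 ‹D.Normal› (commutator_mem_commutator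
    ((hD t).2 (by rw [ht]; exact one_mem _)) (mem_top s))
  obtain ⟨x, z, hz, hx⟩ := hC.exists_eq_pow_mul hp hodd hG 0
    (hC (commutator_mem_commutator (mem_top t) (mem_top s)))
  rw [hx, hD, (commute_of_mem_center_left hz).symm.mul_pow, ← pow_mul, ← pow_succ,
    mul_mem_cancel_right (pow_mem hz p)] at hcD
  have key : ∀ h : G, h ^ p = 1 → Commute ⁅t, s⁆ h := by
    intro h hh
    have := hQ x h hcD (by rw [pow_one, hh]; exact one_mem _) 1 0 rfl
    rw [pow_zero, pow_one h] at this
    rw [hx]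
    exact this.mul_left (commute_of_mem_center_left hz)
  rw [mul_pow_prime_of_commute_commutator hp hodd (key t ht) (key s hs)
    (commutator_pow_eq_one_of_commute (key t ht) (by rw [ht]; exact Commute.one_left s)), ht, hs,
    one_mul]

theorem card_quotient_lt [Finite G] {K : Subgroup G} (hK : K ≠ ⊥) :
    Nat.card (G ⧸ K) < Nat.card G := by
  have h1 := K.card_mul_index
  have h2 : 1 < Nat.card K := K.one_lt_card_iff_ne_bot.2 hK
  rw [← h1]
  exact lt_mul_of_one_lt_left Nat.card_pos h2

theorem CommutatorLePowCenter.torsionClosed_and_powersCommute.{u} {p : ℕ} (hp : p.Prime)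
    (hodd : Odd p) (G : Type u) [Group G] [Finite G] (hG : IsPGroup p G)
    (hC : CommutatorLePowCenter p G) : TorsionClosed p G ∧ ∀ i, PowersCommute p G i := by
  have : Fact p.Prime := ⟨hp⟩
  induction hn : Nat.card G using Nat.strong_induction_on generalizing G with
  | _ n ih =>
    rcases subsingleton_or_nontrivial G with hsub | hnt
    · exact ⟨fun _ _ _ _ _ => Subsingleton.elim _ _, fun _ _ _ _ _ _ _ _ => Subsingleton.elim _ _⟩
    have hZ : center G ≠ ⊥ := (Subgroup.nontrivial_iff_ne_bot _).1 hG.center_nontrivial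
    have ih' (K : Subgroup G) [K.Normal] (hK : K ≠ ⊥) :
        TorsionClosed p (G ⧸ K) ∧ ∀ i, PowersCommute p (G ⧸ K) i :=
      ih _ (hn ▸ card_quotient_lt hK) _ (hG.to_quotient K) (hC.quotient K) rfl
    have hE := (ih' _ hZ).1 1
    rw [pow_one] at hE
    let D := (rootSubgroup p hE).comap (QuotientGroup.mk' (center G))
    have := rootSubgroup_normal hE
    have hDn : D.Normal := inferInstanceAs (Subgroup.Normal (Subgroup.comap _ _))
    have hD : ∀ x, x ∈ D ↔ x ^ p ∈ center G := by
      intro x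
      rw [mem_comap, mem_rootSubgroup, ← map_pow]
      exact QuotientGroup.eq_one_iff _
    have hZD : center G ≤ D := fun z hz => (hD z).2 (pow_mem hz p)
    have hQ := hC.powersCommute hp hodd hG hD (ih' D (ne_bot_of_le_ne_bot hZ hZD)).2
    refine ⟨fun i => ?_, hQ⟩
    have hE1 := hC.mul_pow_eq_one hp hodd hG hD (hQ 1)
    have := rootSubgroup_normal hE1
    have hT : rootSubgroup p hE1 ≠ ⊥ := by
      obtain ⟨g, hg⟩ := exists_prime_orderOf_dvd_card' (G := G) p (hG.card_eq_or_dvd.resolve_left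
        Finite.one_lt_card.ne')
      intro h0
      have h1 : g ∈ rootSubgroup p hE1 := mem_rootSubgroup.2 (hg ▸ pow_orderOf_eq_one g)
      rw [h0, mem_bot, ← orderOf_eq_one_iff, hg] at h1
      exact hp.one_lt.ne' h1
    cases i with
    | zero =>
      intro a b ha hb
      rw [pow_zero, pow_one] at *
      rw [ha, hb, one_mul]
    | succ i =>
      intro a b ha hb
      have hmk : ∀ x : G, (x : G ⧸ rootSubgroup p hE1) ^ p ^ i = 1 ↔ x ^ p ^ (i + 1) = 1 := by
        intro x
        rw [← QuotientGroup.mk_pow, QuotientGroup.eq_one_iff, mem_rootSubgroup, ← pow_mul,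
          ← pow_succ]
      exact (hmk _).1 ((ih' _ hT).1 i _ _ ((hmk a).2 ha) ((hmk b).2 hb))

end Torsion

theorem index_powSubgroup_eq_card_omega (p : ℕ) (hp : p.Prime) (hodd : Odd p)
    (G : Type*) [Group G] [Finite G]
    (hG : IsPGroup p G) (hQP : IsQuasiPowerful p G) (i : ℕ) :
    (powSubgroup G (p ^ i)).index = Nat.card (omegaSubgroup G (p ^ i)) := by
  have hC := hQP.commutatorLePowCenter
  have hE := (hC.torsionClosed_and_powersCommute hp hodd G hG).1 i
  have homega : omegaSubgroup G (p ^ i) = rootSubgroup (p ^ i) hE :=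
    Subgroup.closure_eq (rootSubgroup (p ^ i) hE)
  rw [hC.card_pow_eq_one hp hodd hG, homega]
  rfl
end
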